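/- Fix k ≥ 2 and let σ_1,…,σ_k be independent uniform random elements of S_n. Define the random variable G_{n,2k} = (k−1)n/2 − C(σ_1⋯σ_k·σ_1⁻¹⋯σ_k⁻¹)/2 + 1 if k is even, and G_{n,2k} = (k−1)n/2 − (C(σ_1⋯σ_k) + C(σ_1⁻¹⋯σ_k⁻¹))/2 + 1 if k is odd. Then for even k: E[G_{n,2k}] = (k−1)n/2 − log(n)/2 − γ/2 + 1 + o(1) and Var[G_{n,2k}] = log(n)/4 + γ/4 − π²/24 + o(1); for odd k: E[G_{n,2k}] = (k−1)n/2 − log(n) − γ + 1 + o(1) and Var[G_{n,2k}] = log(n)/2 + γ/2 − π²/12 + o(1). -/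

import Mathlib

/-- Number of cycles of a permutation of `Fin n`, counting fixed points as 1-cycles. -/
def numCycles {n : ℕ} (π : Equiv.Perm (Fin n)) : ℕ :=
  Multiset.card π.cycleType + (Finset.univ.filter fun i => π i = i).card

/-- Expectation with respect to the uniform measure on `S_n^k`. -/
noncomputable def expectK (n k : ℕ) (f : (Fin k → Equiv.Perm (Fin n)) → ℝ) : ℝ :=
  (∑ v : Fin k → Equiv.Perm (Fin n), f v) / (n.factorial : ℝ) ^ k

/-- The genus random variable for even `k`:
`G_{n,2k} = (k-1)n/2 - C(σ_1⋯σ_k·σ_1⁻¹⋯σ_k⁻¹)/2 + 1`. -/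
noncomputable def genusEven (n k : ℕ) (v : Fin k → Equiv.Perm (Fin n)) : ℝ :=
  ((k : ℝ) - 1) * n / 2
    - (numCycles ((List.ofFn v).prod * (List.ofFn fun i => (v i)⁻¹).prod) : ℝ) / 2 + 1

/-- The genus random variable for odd `k`:
`G_{n,2k} = (k-1)n/2 - (C(σ_1⋯σ_k) + C(σ_1⁻¹⋯σ_k⁻¹))/2 + 1`. -/
noncomputable def genusOdd (n k : ℕ) (v : Fin k → Equiv.Perm (Fin n)) : ℝ :=
  ((k : ℝ) - 1) * n / 2
    - ((numCycles (List.ofFn v).prod : ℝ)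
        + (numCycles (List.ofFn fun i => (v i)⁻¹).prod : ℝ)) / 2 + 1

section
open Equiv Equiv.Perm

lemma nc_eq {n : ℕ} (π : Perm (Fin n)) : numCycles π = Multiset.card π.cycleType + (n - π.cycleType.sum) := by
  unfold numCycles
  congr 1
  rw [Equiv.Perm.sum_cycleType]
  have := Finset.card_compl π.support
  rw [Fintype.card_fin] at this
  rw [← this]
  congr 1
  ext i; simp

lemma nc_conj {n : ℕ} (g π : Perm (Fin n)) : numCycles (g * π * g⁻¹) = numCycles π := by
  rw [nc_eq, nc_eq, Equiv.Perm.cycleType_conj]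

lemma nc_inv {n : ℕ} (π : Perm (Fin n)) : numCycles (π⁻¹) = numCycles π := by
  rw [nc_eq, nc_eq, Equiv.Perm.cycleType_inv]

lemma nc_comm {n : ℕ} (g π : Perm (Fin n)) : numCycles (g * π) = numCycles (π * g) := by
  rw [← nc_conj π (g * π)]; group

noncomputable def cycMark {n : ℕ} (π : Perm (Fin n)) (x : Fin n) : Perm (Fin n) × Option (Fin n) :=
  (cycleOf π x, if π x = x then some x else none)

lemma cycMark_eq_iff {n : ℕ} (π : Perm (Fin n)) (x y : Fin n) :
    cycMark π x = cycMark π y ↔ SameCycle π x y := by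
  constructor
  · intro h
    simp only [cycMark, Prod.mk.injEq] at h
    obtain ⟨h1, h2⟩ := h
    by_cases hx : π x = x
    · by_cases hy : π y = y
      · simp only [hx, hy, if_true, Option.some.injEq] at h2
        subst h2; exact SameCycle.refl _ _
      · simp [hx, hy] at h2
    · by_cases hy : π y = y
      · simp [hx, hy] at h2
      · exact (sameCycle_iff_cycleOf_eq_of_mem_support (by simpa using hx) (by simpa using hy)).2 h1
  · intro h
    by_cases hx : π x = x
    · have : x = y := by
        obtain ⟨i, hi⟩ := h
        rw [← hi]; exact (zpow_apply_eq_self_of_apply_eq_self hx i).symm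
      subst this; rfl
    · have hy : ¬ π y = y := fun hy => hx ((h.apply_eq_self_iff).2 hy)
      simp [cycMark, hx, hy, h.cycleOf_eq]

lemma card_image_cycMark {n : ℕ} (π : Perm (Fin n)) :
    (Finset.univ.image (cycMark π)).card = numCycles π := by
  have : Finset.univ.image (cycMark π) =
      (π.cycleFactorsFinset.image (fun c => (c, (none : Option (Fin n))))) ∪
      ((Finset.univ.filter fun i => π i = i).image (fun i => ((1 : Perm (Fin n)), some i))) := by
    ext ⟨c, o⟩
    simp only [Finset.mem_image, Finset.mem_univ, true_and, Finset.mem_union, Finset.mem_filter,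
      Prod.mk.injEq, cycMark]
    constructor
    · rintro ⟨x, hx, rfl⟩
      by_cases h : π x = x
      · right; exact ⟨x, h, by rw [← hx]; exact ((cycleOf_eq_one_iff π).2 h).symm, by simp [h]⟩
      · left; exact ⟨c, by rw [← hx]; exact cycleOf_mem_cycleFactorsFinset_iff.2 (by simpa using h), rfl, by simp [h]⟩
    · rintro (⟨a, ha, rfl, rfl⟩ | ⟨a, ha, rfl, rfl⟩)
      · obtain ⟨x, hx⟩ := ((mem_cycleFactorsFinset_iff.1 ha).1).nonempty_support
        have := cycle_is_cycleOf hx ha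
        refine ⟨x, this.symm, ?_⟩
        rw [if_neg]
        have := mem_cycleFactorsFinset_support_le ha hx
        simpa using this
      · exact ⟨a, (cycleOf_eq_one_iff π).2 ha, by simp [ha]⟩
  rw [this, Finset.card_union_of_disjoint, Finset.card_image_of_injective, Finset.card_image_of_injective]
  · unfold numCycles
    congr 1
    simp [cycleType_def]
  · intro a b h; simpa using h
  · intro a b h; simpa using h
  · rw [Finset.disjoint_left]; intro a h1 h2
    simp only [Finset.mem_image] at h1 h2
    obtain ⟨b, _, rfl⟩ := h1
    obtain ⟨b', _, h⟩ := h2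
    simp at h

lemma card_quot {n : ℕ} (π : Perm (Fin n)) :
    Nat.card (Quotient (SameCycle.setoid π)) = numCycles π := by
  have h : SameCycle.setoid π = Setoid.ker (cycMark π) := by
    ext x y
    exact (cycMark_eq_iff π x y).symm
  rw [h, Nat.card_congr (Setoid.quotientKerEquivRange (cycMark π)), ← card_image_cycMark]
  rw [← Set.ncard_coe_finset, Nat.card_coe_set_eq]
  simp

lemma card_invCol {n : ℕ} (π : Perm (Fin n)) :
    Nat.card {f : Fin n → Bool // ∀ x, f (π x) = f x} = 2 ^ numCycles π := by
  have e : {f : Fin n → Bool // ∀ x, f (π x) = f x} ≃ (Quotient (SameCycle.setoid π) → Bool) :=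
    { toFun := fun f => Quotient.lift f.1 (by
        rintro a b ⟨i, rfl⟩
        have key : ∀ (x : Fin n), ∀ m : ℕ, f.1 ((π ^ m) x) = f.1 x := by
          intro x m
          induction m with
          | zero => rfl
          | succ m ih => rw [pow_succ', Perm.mul_apply, f.2, ih]
        cases i with
        | ofNat m => exact (key a m).symm
        | negSucc m =>
          have := key ((π ^ (Int.negSucc m)) a) (m+1)
          rw [← this]
          simp)
      invFun := fun g => ⟨fun x => g (Quotient.mk _ x), fun x => congrArg g (Quotient.sound (by
        show SameCycle π (π x) x
        exact (sameCycle_apply_left).2 (SameCycle.refl _ _)))⟩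
      left_inv := fun f => rfl
      right_inv := fun g => by
        funext x
        induction x using Quotient.inductionOn
        rfl }
  rw [Nat.card_congr e, Nat.card_fun, card_quot]
  simp

lemma nc_mul_swap {n : ℕ} (σ : Perm (Fin n)) (e r : Fin n) (he : σ e = e) (hr : e ≠ r) :
    numCycles (σ * swap e r) + 1 = numCycles σ := by
  have key : 2 ^ (numCycles (σ * swap e r) + 1) = 2 ^ numCycles σ := by
    rw [pow_succ, ← card_invCol, ← card_invCol]
    have h1 : ∀ f : Fin n → Bool, (∀ x, f ((σ * swap e r) x) = f x) ↔ ((∀ x, f (σ x) = f x) ∧ f e = f r) := by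
      intro f
      constructor
      · intro h
        have ha := h e
        have hb := h r
        simp only [Perm.mul_apply, swap_apply_left, swap_apply_right, he] at ha hb
        refine ⟨fun x => ?_, hb⟩
        by_cases hx : x = e
        · rw [hx, he]
        by_cases hx' : x = r
        · rw [hx', ha, hb]
        have := h x
        rwa [Perm.mul_apply, swap_apply_of_ne_of_ne hx hx'] at this
      · rintro ⟨h, h2⟩ x
        rw [Perm.mul_apply, h]
        by_cases hx : x = e
        · rw [hx, swap_apply_left, h2]
        by_cases hx' : x = r
        · rw [hx', swap_apply_right, h2]
        rw [swap_apply_of_ne_of_ne hx hx']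
    have e1 : {f : Fin n → Bool // ∀ x, f (σ x) = f x} ≃
        {f : Fin n → Bool // ∀ x, f ((σ * swap e r) x) = f x} × Bool :=
      { toFun := fun f => (⟨Function.update f.1 e (f.1 r), by
          rw [h1]
          refine ⟨fun x => ?_, by simp [Function.update_of_ne hr.symm]⟩
          by_cases hx : x = e
          · rw [hx, he]
          have : σ x ≠ e := fun h => hx (σ.injective (h.trans he.symm))
          rw [Function.update_of_ne hx, Function.update_of_ne this, f.2]⟩, f.1 e)
        invFun := fun p => ⟨Function.update p.1.1 e p.2, by
          intro x
          have := (h1 _).1 p.1.2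
          by_cases hx : x = e
          · rw [hx, he]
          have h' : σ x ≠ e := fun h => hx (σ.injective (h.trans he.symm))
          rw [Function.update_of_ne hx, Function.update_of_ne h', this.1]⟩
        left_inv := fun f => by ext x; simp
        right_inv := fun p => by
          have := (h1 _).1 p.1.2
          ext x
          · simp [Function.update_of_ne hr.symm, ← this.2]
          · simp }
    rw [Nat.card_congr e1, Nat.card_prod]
    simp
  exact Nat.pow_right_injective (le_refl 2) key

end

section
open Equiv Equiv.Perm

/-- permutations supported in `D` preserving the labelling `row`. -/
def labG {n : ℕ} (row : Fin n → ℕ) (D : Finset (Fin n)) : Finset (Perm (Fin n)) :=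
  Finset.univ.filter (fun p => (∀ x, row (p x) = row x) ∧ ∀ x, x ∉ D → p x = x)

lemma mem_labG {n : ℕ} {row : Fin n → ℕ} {D : Finset (Fin n)} {p : Perm (Fin n)} :
    p ∈ labG row D ↔ (∀ x, row (p x) = row x) ∧ ∀ x, x ∉ D → p x = x := by
  simp [labG]

lemma labG_one {n : ℕ} {row : Fin n → ℕ} {D : Finset (Fin n)} : (1 : Perm (Fin n)) ∈ labG row D := by
  simp [mem_labG]

lemma labG_mul {n : ℕ} {row : Fin n → ℕ} {D : Finset (Fin n)} {p q : Perm (Fin n)}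
    (hp : p ∈ labG row D) (hq : q ∈ labG row D) : p * q ∈ labG row D := by
  rw [mem_labG] at *
  refine ⟨fun x => by rw [Perm.mul_apply, hp.1, hq.1], fun x hx => by rw [Perm.mul_apply, hq.2 x hx, hp.2 x hx]⟩

lemma labG_inv {n : ℕ} {row : Fin n → ℕ} {D : Finset (Fin n)} {p : Perm (Fin n)}
    (hp : p ∈ labG row D) : p⁻¹ ∈ labG row D := by
  rw [mem_labG] at *
  refine ⟨fun x => ?_, fun x hx => ?_⟩
  · have := hp.1 (p⁻¹ x); simpa using this.symm
  · rw [Perm.inv_eq_iff_eq, hp.2 x hx]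

lemma labG_mono {n : ℕ} {row : Fin n → ℕ} {D E : Finset (Fin n)} (h : D ⊆ E) {p : Perm (Fin n)}
    (hp : p ∈ labG row D) : p ∈ labG row E := by
  rw [mem_labG] at *
  exact ⟨hp.1, fun x hx => hp.2 x (fun h' => hx (h h'))⟩

lemma labG_swap {n : ℕ} {row : Fin n → ℕ} {D : Finset (Fin n)} {a b : Fin n} (ha : a ∈ D) (hb : b ∈ D)
    (h : row a = row b) : swap a b ∈ labG row D := by
  rw [mem_labG]
  refine ⟨fun x => ?_, fun x hx => swap_apply_of_ne_of_ne (fun h => hx (h ▸ ha)) (fun h => hx (h ▸ hb))⟩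
  by_cases h1 : x = a
  · rw [h1, swap_apply_left, h]
  by_cases h2 : x = b
  · rw [h2, swap_apply_right, h]
  rw [swap_apply_of_ne_of_ne h1 h2]

lemma labG_sum_inv {n : ℕ} (row : Fin n → ℕ) (D : Finset (Fin n)) (F : Perm (Fin n) → ℝ) :
    ∑ p ∈ labG row D, F p⁻¹ = ∑ p ∈ labG row D, F p := by
  refine Finset.sum_nbij' (fun p => p⁻¹) (fun p => p⁻¹) ?_ ?_ ?_ ?_ ?_
  · intro p hp; exact labG_inv hp
  · intro p hp; exact labG_inv hp
  · intro p _; simp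
  · intro p _; simp
  · intro p _; simp

lemma labG_sum_mul_right {n : ℕ} (row : Fin n → ℕ) (D : Finset (Fin n)) (F : Perm (Fin n) → ℝ)
    {g : Perm (Fin n)} (hg : g ∈ labG row D) :
    ∑ p ∈ labG row D, F (p * g) = ∑ p ∈ labG row D, F p := by
  refine Finset.sum_nbij' (fun p => p * g) (fun p => p * g⁻¹) ?_ ?_ ?_ ?_ ?_
  · intro p hp; exact labG_mul hp hg
  · intro p hp; exact labG_mul hp (labG_inv hg)
  · intro p _; simp
  · intro p _; simp
  · intro p _; simp

lemma labG_sum_mul_left {n : ℕ} (row : Fin n → ℕ) (D : Finset (Fin n)) (F : Perm (Fin n) → ℝ)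
    {g : Perm (Fin n)} (hg : g ∈ labG row D) :
    ∑ p ∈ labG row D, F (g * p) = ∑ p ∈ labG row D, F p := by
  refine Finset.sum_nbij' (fun p => g * p) (fun p => g⁻¹ * p) ?_ ?_ ?_ ?_ ?_
  · intro p hp; exact labG_mul hg hp
  · intro p hp; exact labG_mul (labG_inv hg) hp
  · intro p _; simp
  · intro p _; simp
  · intro p _; simp

lemma labG_sum_insert {n : ℕ} (row : Fin n → ℕ) (D : Finset (Fin n)) (e : Fin n) (he : e ∉ D)
    (F : Perm (Fin n) → ℝ) :
    ∑ p ∈ labG row (insert e D), F p =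
      ∑ r ∈ (insert e D).filter (fun r => row r = row e), ∑ p ∈ labG row D, F (p * swap e r) := by
  rw [← Finset.sum_product']
  symm
  refine Finset.sum_nbij' (fun a => a.2 * swap e a.1) (fun p => (p⁻¹ e, p * swap e (p⁻¹ e))) ?_ ?_ ?_ ?_ ?_
  · rintro ⟨r, p⟩ h
    simp only [Finset.mem_product, Finset.mem_filter] at h
    refine labG_mul (labG_mono (Finset.subset_insert _ _) h.2) (labG_swap (Finset.mem_insert_self _ _) h.1.1 h.1.2.symm)
  · intro p hp
    have hp' := labG_inv hp
    have hmem : p⁻¹ e ∈ insert e D := by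
      by_contra hh
      have h1 := (mem_labG.1 hp).2 _ hh
      rw [show p (p⁻¹ e) = e from p.apply_symm_apply e] at h1
      rw [← h1] at hh
      exact hh (Finset.mem_insert_self _ _)
    simp only [Finset.mem_product, Finset.mem_filter]
    refine ⟨⟨hmem, (mem_labG.1 hp').1 e⟩, ?_⟩
    have h3 : p * swap e (p⁻¹ e) ∈ labG row (insert e D) :=
      labG_mul hp (labG_swap (Finset.mem_insert_self _ _) hmem ((mem_labG.1 hp').1 e).symm)
    rw [mem_labG] at h3 ⊢
    refine ⟨h3.1, fun x hx => ?_⟩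
    by_cases hxe : x = e
    · rw [hxe]; simp
    · exact h3.2 x (by simp [hxe, hx])
  · rintro ⟨r, p⟩ h
    simp only [Finset.mem_product, Finset.mem_filter] at h
    have h1 : p e = e := (mem_labG.1 h.2).2 e he
    have h2 : p⁻¹ e = e := by rw [Perm.inv_eq_iff_eq, h1]
    have h3 : (p * swap e r)⁻¹ e = r := by
      rw [Perm.inv_eq_iff_eq, Perm.mul_apply, swap_apply_right, h1]
    simp only [h3, mul_assoc, swap_mul_self, mul_one]
  · intro p _
    simp only [mul_assoc, swap_mul_self, mul_one]
  · intro a _; rfl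

lemma labG_sum_insert' {n : ℕ} (row : Fin n → ℕ) (D : Finset (Fin n)) (e : Fin n) (he : e ∉ D)
    (F : Perm (Fin n) → ℝ) :
    ∑ p ∈ labG row (insert e D), F p =
      ∑ r ∈ (insert e D).filter (fun r => row r = row e), ∑ p ∈ labG row D, F (swap e r * p) := by
  rw [← labG_sum_inv, labG_sum_insert _ _ _ he]
  refine Finset.sum_congr rfl fun r _ => ?_
  rw [← labG_sum_inv]
  simp

noncomputable def ySum {n : ℕ} (row col : Fin n → ℕ) (D : Finset (Fin n)) (f : Perm (Fin n) → ℝ) : ℝ :=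
  ∑ p ∈ labG row D, ∑ q ∈ labG col D, ((sign q : ℤ) : ℝ) * f (p * q)

structure IsLow {n : ℕ} (row col : Fin n → ℕ) (D : Finset (Fin n)) : Prop where
  inj : ∀ x y, row x = row y → col x = col y → x = y
  low : ∀ x ∈ D, ∀ i j, i ≤ row x → j ≤ col x → ∃ y ∈ D, row y = i ∧ col y = j

set_option maxHeartbeats 1000000 in
lemma ySum_step {n : ℕ} (row col : Fin n → ℕ) (D : Finset (Fin n)) (e : Fin n) (he : e ∉ D)
    (hl : IsLow row col (insert e D)) (hmax : ∀ x ∈ D, row x + col x ≤ row e + col e) (x : ℝ) :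
    x * ySum row col (insert e D) (fun g => x ^ numCycles g) =
      (x + col e - row e) * ySum row col D (fun g => x ^ numCycles g) := by
  have fixp : ∀ {lab : Fin n → ℕ} {p}, p ∈ labG lab D → p e = e := fun h => (mem_labG.1 h).2 e he
  set S := ySum row col D (fun g => x ^ numCycles g) with hS
  set t : Fin n → Fin n → ℝ := fun r c => ∑ p ∈ labG row D, ∑ q ∈ labG col D,
    ((sign (swap e c * q) : ℤ) : ℝ) * x ^ numCycles (p * swap e r * (swap e c * q)) with ht
  have hexp : ySum row col (insert e D) (fun g => x ^ numCycles g) =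
      ∑ r ∈ (insert e D).filter (fun r => row r = row e),
      ∑ c ∈ (insert e D).filter (fun r => col r = col e), t r c := by
    unfold ySum
    rw [labG_sum_insert _ _ _ he]
    refine Finset.sum_congr rfl fun r _ => ?_
    exact (Finset.sum_congr rfl fun p _ => labG_sum_insert' _ _ _ he _).trans Finset.sum_comm
  have hse : swap e e = (1 : Perm (Fin n)) := swap_self e
  have hee : t e e = S := by simp [ht, hS, ySum, hse, -swap_self]
  have hre : ∀ r, r ≠ e → x * t r e = S := by
    intro r hr
    simp only [ht, hS, ySum, Finset.mul_sum]
    refine Finset.sum_congr rfl fun p hp => Finset.sum_congr rfl fun q hq => ?_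
    have : numCycles (p * q) = numCycles (p * swap e r * q) + 1 := by
      rw [nc_comm (p * swap e r), ← mul_assoc, nc_mul_swap _ _ _ _ hr.symm, nc_comm]
      simp [fixp hp, fixp hq]
    simp [this, pow_succ, hse, -swap_self]; ring
  have hec : ∀ c, c ≠ e → x * t e c = - S := by
    intro r hr
    simp only [ht, hS, ySum, Finset.mul_sum, ← Finset.sum_neg_distrib]
    refine Finset.sum_congr rfl fun p hp => Finset.sum_congr rfl fun q hq => ?_
    have : numCycles (p * q) = numCycles (p * (swap e r * q)) + 1 := by
      rw [← mul_assoc, nc_comm (p * swap e r), ← mul_assoc, nc_mul_swap _ _ _ _ hr.symm, nc_comm]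
      simp [fixp hp, fixp hq]
    simp [this, pow_succ, sign_swap hr.symm, hse, -swap_self]; ring
  have hrc : ∀ r ∈ D, row r = row e → ∀ c ∈ D, col c = col e → x * t r c = 0 := by
    intro r hr hre c hc hce
    have hrne : r ≠ e := fun h => he (h ▸ hr)
    have hcne : c ≠ e := fun h => he (h ▸ hc)
    have hrcne : r ≠ c := by
      intro h; subst h; exact hrne (hl.inj _ _ hre hce)
    have hcr : col r < col e := by
      have h1 := hmax r hr
      rcases lt_or_eq_of_le (show col r ≤ col e by omega) with h | h
      · exact h
      · exact absurd (hl.inj _ _ hre h) hrne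
    have hrc' : row c < row e := by
      have h1 := hmax c hc
      rcases lt_or_eq_of_le (show row c ≤ row e by omega) with h | h
      · exact h
      · exact absurd (hl.inj _ _ h hce) hcne
    obtain ⟨d, hd, hd1, hd2⟩ := hl.low e (Finset.mem_insert_self _ _) (row c) (col r) hrc'.le hcr.le
    have hdD : d ∈ D := by
      rcases Finset.mem_insert.1 hd with h | h
      · subst h; omega
      · exact h
    have hdc : d ≠ c := by intro h; subst h; omega
    have hdr : d ≠ r := by intro h; subst h; omega
    have e1 : x * t r c = - ∑ p ∈ labG row D, ∑ q ∈ labG col D,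
        ((sign q : ℤ) : ℝ) * x ^ numCycles (p * swap c r * q) := by
      simp only [ht, Finset.mul_sum, ← Finset.sum_neg_distrib]
      refine Finset.sum_congr rfl fun p hp => Finset.sum_congr rfl fun q hq => ?_
      have hs : swap e r * swap e c = swap c r * swap e r := by
        rw [Equiv.mul_swap_eq_swap_mul, swap_apply_left, swap_apply_of_ne_of_ne hcne hrcne.symm, swap_comm r c]
      have : numCycles (p * swap c r * q) = numCycles (p * swap e r * (swap e c * q)) + 1 := by
        rw [show p * swap e r * (swap e c * q) = p * swap c r * swap e r * q by
          rw [mul_assoc p (swap c r), ← hs]; simp [mul_assoc]]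
        rw [nc_comm (p * swap c r * swap e r) q, ← mul_assoc q, nc_mul_swap _ _ _ _ hrne.symm, nc_comm q]
        simp [fixp hp, fixp hq, swap_apply_of_ne_of_ne hcne.symm hrne.symm]
      simp [this, pow_succ, sign_swap hcne.symm]; ring
    have e2 : ∑ p ∈ labG row D, ∑ q ∈ labG col D,
        ((sign q : ℤ) : ℝ) * x ^ numCycles (p * swap c r * q) = - ∑ p ∈ labG row D, ∑ q ∈ labG col D,
        ((sign q : ℤ) : ℝ) * x ^ numCycles (p * swap c r * q) := by
      conv_lhs => rw [← labG_sum_mul_right row D _ (labG_swap hdD hc hd1)]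
      rw [← Finset.sum_neg_distrib]
      refine Finset.sum_congr rfl fun p hp => ?_
      rw [← labG_sum_mul_left col D _ (labG_swap hdD hr hd2), ← Finset.sum_neg_distrib]
      refine Finset.sum_congr rfl fun q hq => ?_
      have hs : swap d c * swap c r * swap d r = swap c r := by
        have h5 : swap c r * swap d r = swap d c * swap c r := by
          rw [Equiv.mul_swap_eq_swap_mul, swap_apply_right, swap_apply_of_ne_of_ne hdc hdr]
        rw [← h5, mul_assoc, swap_mul_self, mul_one]
      rw [show p * swap d c * swap c r * (swap d r * q) = p * (swap d c * swap c r * swap d r) * q by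
        simp [mul_assoc], hs]
      simp [sign_swap hdr]
    rw [e1]; linarith
  have hrow : (D.filter (fun r => row r = row e)).card = col e := by
    rw [← Finset.card_range (col e)]
    refine Finset.card_nbij col ?_ ?_ ?_
    · intro r hr
      simp only [Finset.coe_filter, Set.mem_ofPred_eq, Finset.coe_range, Set.mem_Iio] at *
      have h1 := hmax r hr.1
      rcases lt_or_eq_of_le (show col r ≤ col e by omega) with h | h
      · exact h
      · exact absurd hr.1 (hl.inj _ _ hr.2 h ▸ he)
    · intro a ha b hb hab
      simp at ha hb
      exact hl.inj _ _ (ha.2.trans hb.2.symm) hab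
    · intro j hj
      simp at hj
      obtain ⟨y, hy, h1, h2⟩ := hl.low e (Finset.mem_insert_self _ _) (row e) j le_rfl hj.le
      refine ⟨y, ?_, h2⟩
      simp only [Finset.coe_filter, Set.mem_ofPred_eq]
      refine ⟨?_, h1⟩
      rcases Finset.mem_insert.1 hy with h | h
      · subst h; omega
      · exact h
  have hcol : (D.filter (fun r => col r = col e)).card = row e := by
    rw [← Finset.card_range (row e)]
    refine Finset.card_nbij row ?_ ?_ ?_
    · intro r hr
      simp only [Finset.coe_filter, Set.mem_ofPred_eq, Finset.coe_range, Set.mem_Iio] at *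
      have h1 := hmax r hr.1
      rcases lt_or_eq_of_le (show row r ≤ row e by omega) with h | h
      · exact h
      · exact absurd hr.1 (hl.inj _ _ h hr.2 ▸ he)
    · intro a ha b hb hab
      simp at ha hb
      exact hl.inj _ _ hab (ha.2.trans hb.2.symm)
    · intro j hj
      simp at hj
      obtain ⟨y, hy, h1, h2⟩ := hl.low e (Finset.mem_insert_self _ _) j (col e) hj.le le_rfl
      refine ⟨y, ?_, h1⟩
      simp only [Finset.coe_filter, Set.mem_ofPred_eq]
      refine ⟨?_, h2⟩
      rcases Finset.mem_insert.1 hy with h | h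
      · subst h; omega
      · exact h
  have hne1 : e ∉ D.filter (fun r => row r = row e) := fun h => he (Finset.mem_filter.1 h).1
  have hne2 : e ∉ D.filter (fun r => col r = col e) := fun h => he (Finset.mem_filter.1 h).1
  rw [hexp, Finset.filter_insert, if_pos rfl, Finset.filter_insert, if_pos rfl, Finset.sum_insert hne1,
    Finset.sum_insert hne2, mul_add, mul_add, hee, Finset.mul_sum, Finset.mul_sum,
    Finset.sum_congr rfl (fun c hc => hec c (fun h => he (h ▸ (Finset.mem_filter.1 hc).1))),
    Finset.sum_const, hcol]
  have : ∀ r ∈ D.filter (fun r => row r = row e), x * (∑ c ∈ insert e (D.filter (fun r => col r = col e)), t r c) = S := by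
    intro r hr
    have hr' := Finset.mem_filter.1 hr
    rw [Finset.sum_insert hne2, mul_add, hre r (fun h => he (h ▸ hr'.1)), Finset.mul_sum,
      Finset.sum_eq_zero, add_zero]
    intro c hc
    have hc' := Finset.mem_filter.1 hc
    exact hrc r hr'.1 hr'.2 c hc'.1 hc'.2
  rw [Finset.sum_congr rfl this, Finset.sum_const, hrow]
  simp only [nsmul_eq_mul]
  ring

lemma nc_one {n : ℕ} : numCycles (1 : Perm (Fin n)) = n := by
  simp [numCycles]

lemma ySum_pow {n : ℕ} (row col : Fin n → ℕ) (x : ℝ) : ∀ (m : ℕ) (D : Finset (Fin n)), D.card = m →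
    IsLow row col D →
    x ^ m * ySum row col D (fun g => x ^ numCycles g) = x ^ n * ∏ e ∈ D, (x + col e - row e) := by
  intro m
  induction m with
  | zero =>
    intro D hD _
    rw [Finset.card_eq_zero] at hD
    subst hD
    have : ∀ lab : Fin n → ℕ, labG lab ∅ = {1} := by
      intro lab
      ext p
      simp only [mem_labG, Finset.mem_singleton]
      constructor
      · intro h; ext x; simp [h.2 x]
      · rintro rfl; simp
    simp [ySum, this, nc_one]
  | succ m ih =>
    intro D hD hl
    have hne : D.Nonempty := by rw [← Finset.card_pos]; omega
    obtain ⟨e, he, hmax⟩ := Finset.exists_max_image D (fun x => row x + col x) hne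
    have hins : insert e (D.erase e) = D := Finset.insert_erase he
    have h1 := ySum_step row col (D.erase e) e (Finset.notMem_erase _ _) (by rwa [hins])
      (fun y hy => hmax y (Finset.mem_of_mem_erase hy)) x
    have hl' : IsLow row col (D.erase e) := by
      refine ⟨hl.inj, fun y hy i j hi hj => ?_⟩
      obtain ⟨z, hz, hz1, hz2⟩ := hl.low y (Finset.mem_of_mem_erase hy) i j hi hj
      refine ⟨z, Finset.mem_erase.2 ⟨?_, hz⟩, hz1, hz2⟩
      rintro rfl
      have := hmax y (Finset.mem_of_mem_erase hy)
      exact Finset.ne_of_mem_erase hy (hl.inj _ _ (by omega) (by omega))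
    have h2 := ih (D.erase e) (by rw [Finset.card_erase_of_mem he, hD]; rfl) hl'
    rw [hins] at h1
    rw [pow_succ, mul_assoc, h1, mul_left_comm, h2, ← Finset.mul_prod_erase D _ he]
    ring

lemma ySum_univ {n : ℕ} (row col : Fin n → ℕ) (x : ℝ) (hx : x ≠ 0) (h : IsLow row col Finset.univ) :
    ySum row col Finset.univ (fun g => x ^ numCycles g) = ∏ e, (x + col e - row e) := by
  have := ySum_pow row col x n Finset.univ (by simp) h
  exact mul_left_cancel₀ (pow_ne_zero _ hx) this

end

section
open Equiv Equiv.Perm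

lemma sum_ge_range (s : Finset ℕ) (k : ℕ) (hs : s.card = k) :
    ∑ x ∈ Finset.range k, x + (s \ Finset.range k).card ≤ ∑ x ∈ s, x := by
  have h1 := Finset.sum_inter_add_sum_sdiff s (Finset.range k) (fun x => x)
  have h2 := Finset.sum_inter_add_sum_sdiff (Finset.range k) s (fun x => x)
  have h3 : (s \ Finset.range k).card = (Finset.range k \ s).card :=
    Finset.card_sdiff_comm (by simp [hs])
  have h4 : (s \ Finset.range k).card • k ≤ ∑ x ∈ s \ Finset.range k, x :=
    Finset.card_nsmul_le_sum _ _ _ (fun x hx => by simp at hx; exact hx.2)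
  have h5 : ∑ x ∈ Finset.range k \ s, (x + 1) ≤ (Finset.range k \ s).card • k :=
    Finset.sum_le_card_nsmul _ _ _ (fun x hx => by simp at hx; omega)
  rw [Finset.sum_add_distrib] at h5
  rw [Finset.inter_comm] at h2
  simp only [Finset.sum_const, smul_eq_mul, mul_one] at *
  rw [h3] at h4 ⊢
  omega

lemma lower_eq_range (T : Finset ℕ) (h : ∀ x ∈ T, ∀ y ≤ x, y ∈ T) : T = Finset.range T.card := by
  apply Finset.eq_of_subset_of_card_le
  · intro j hj
    have : Finset.range (j+1) ⊆ T := fun y hy => h j hj y (by simp at hy; omega)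
    have := Finset.card_le_card this
    simp at this ⊢; omega
  · simp

lemma vn_comb {n : ℕ} (row col : Fin n → ℕ) (hl : IsLow row col Finset.univ) (g : Perm (Fin n))
    (h : ∀ i j, row i = row j → col (g⁻¹ i) = col (g⁻¹ j) → i = j) :
    ∃ p ∈ labG row Finset.univ, ∃ q ∈ labG col Finset.univ, g = p * q := by
  set κ : Fin n → ℕ := fun x => col (g⁻¹ x) with hκ
  let R : ℕ → Finset (Fin n) := fun i => Finset.univ.filter (fun x => row x = i)
  have hcol : ∀ i, (R i).image col = Finset.range (R i).card := by
    intro i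
    have hc : ((R i).image col).card = (R i).card := Finset.card_image_of_injOn (by
      intro a ha b hb hab
      simp [R] at ha hb
      exact hl.inj _ _ (ha.trans hb.symm) hab)
    rw [← hc]
    apply lower_eq_range
    intro x hx y hy
    simp only [Finset.mem_image] at hx ⊢
    obtain ⟨a, ha, rfl⟩ := hx
    simp [R] at ha
    obtain ⟨z, _, hz1, hz2⟩ := hl.low a (Finset.mem_univ _) (row a) y le_rfl hy
    exact ⟨z, by simp [R, hz1, ha], hz2⟩
  have hcs : ∀ i, ∑ x ∈ R i, col x = ∑ x ∈ Finset.range (R i).card, x := by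
    intro i
    rw [← hcol, Finset.sum_image]
    intro a ha b hb hab
    simp [R] at ha hb
    exact hl.inj _ _ (ha.trans hb.symm) hab
  have hinj : ∀ i, Set.InjOn κ (R i) := by
    intro i a ha b hb hab
    simp [R] at ha hb
    exact h _ _ (ha.trans hb.symm) hab
  have hks : ∀ i, ∑ x ∈ Finset.range (R i).card, x + ((R i).image κ \ Finset.range (R i).card).card ≤ ∑ x ∈ R i, κ x := by
    intro i
    have := sum_ge_range ((R i).image κ) (R i).card (Finset.card_image_of_injOn (hinj i))
    rwa [Finset.sum_image (hinj i)] at this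
  have htot : ∑ x, κ x = ∑ x, col x := Equiv.sum_comp g⁻¹ col
  have hmap : ∀ x ∈ (Finset.univ : Finset (Fin n)), row x ∈ Finset.univ.image row := fun x _ => Finset.mem_image_of_mem _ (Finset.mem_univ _)
  rw [← Finset.sum_fiberwise_of_maps_to hmap, ← Finset.sum_fiberwise_of_maps_to hmap] at htot
  have hle := Finset.sum_le_sum (s := Finset.univ.image row) (fun i _ => hks i)
  rw [Finset.sum_add_distrib, htot, ← Finset.sum_congr rfl (fun i _ => hcs i)] at hle
  have hz : ∑ i ∈ Finset.univ.image row, ((R i).image κ \ Finset.range (R i).card).card = 0 := by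
    have : ∑ i ∈ Finset.univ.image row, ∑ x ∈ R i, col x + ∑ i ∈ Finset.univ.image row, ((R i).image κ \ Finset.range (R i).card).card ≤ ∑ i ∈ Finset.univ.image row, ∑ x ∈ R i, col x := hle
    omega
  rw [Finset.sum_eq_zero_iff] at hz
  have hex : ∀ x, ∃ y, row y = row x ∧ κ y = col x := by
    intro x
    have h1 := hz (row x) (hmap x (Finset.mem_univ _))
    rw [Finset.card_eq_zero, Finset.sdiff_eq_empty_iff_subset] at h1
    have h2 := Finset.eq_of_subset_of_card_le h1 (by rw [Finset.card_image_of_injOn (hinj _)]; simp)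
    have h3 : col x ∈ (R (row x)).image κ := by
      rw [h2, ← hcol]; exact Finset.mem_image_of_mem _ (by simp [R])
    obtain ⟨y, hy, hy'⟩ := Finset.mem_image.1 h3
    exact ⟨y, by simpa [R] using hy, hy'⟩
  choose p hp1 hp2 using hex
  have hpi : Function.Injective p := by
    intro a b hab
    apply hl.inj
    · rw [← hp1 a, ← hp1 b, hab]
    · rw [← hp2 a, ← hp2 b, hab]
  let P : Perm (Fin n) := Equiv.ofBijective p (Finite.injective_iff_bijective.1 hpi)
  have hP : ∀ x, P x = p x := fun x => rfl
  have hPm : P ∈ labG row Finset.univ := by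
    rw [mem_labG]; exact ⟨fun x => by rw [hP, hp1], fun x hx => absurd (Finset.mem_univ _) hx⟩
  have hQ : g⁻¹ * P ∈ labG col Finset.univ := by
    rw [mem_labG]; exact ⟨fun x => by rw [Perm.mul_apply, hP]; exact hp2 x, fun x hx => absurd (Finset.mem_univ _) hx⟩
  exact ⟨P, hPm, P⁻¹ * g, by simpa using labG_inv hQ, by simp⟩

abbrev GA (n : ℕ) := MonoidAlgebra ℝ (Perm (Fin n))

noncomputable def toA {n : ℕ} (f : Perm (Fin n) → ℝ) : GA n :=
  MonoidAlgebra.ofCoeff (Finsupp.equivFunOnFinite.symm f)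

@[simp] lemma toA_coeff {n : ℕ} (f : Perm (Fin n) → ℝ) (g : Perm (Fin n)) : (toA f).coeff g = f g := rfl

lemma toA_of_coeff {n : ℕ} (x : GA n) : toA (fun g => x.coeff g) = x := by
  ext g; rfl

lemma toA_eq {n : ℕ} (f : Perm (Fin n) → ℝ) : toA f = ∑ g, f g • MonoidAlgebra.single g (1:ℝ) := by
  ext g
  simp [MonoidAlgebra.coeff_sum, Finsupp.finsetSum_apply, Finsupp.single_apply]

def IsCl {n : ℕ} (f : Perm (Fin n) → ℝ) : Prop := ∀ g h, f (g * h) = f (h * g)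

lemma coeff_smm {n : ℕ} (x : GA n) (p q g : Perm (Fin n)) (s : ℝ) :
    (MonoidAlgebra.single p (1:ℝ) * x * MonoidAlgebra.single q s).coeff g = s * x.coeff (p⁻¹ * g * q⁻¹) := by
  simp [mul_assoc, mul_comm]

lemma toA_central {n : ℕ} {f : Perm (Fin n) → ℝ} (hf : IsCl f) (x : GA n) : x * toA f = toA f * x := by
  have key : ∀ g : Perm (Fin n), MonoidAlgebra.single g (1:ℝ) * toA f = toA f * MonoidAlgebra.single g (1:ℝ) := by
    intro g; ext h; simp [hf g⁻¹ h]
  rw [← toA_of_coeff x, toA_eq (fun g => x.coeff g), Finset.sum_mul, Finset.mul_sum]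
  refine Finset.sum_congr rfl fun g _ => ?_
  rw [smul_mul_assoc, mul_smul_comm, key]

noncomputable def aE {n : ℕ} (row : Fin n → ℕ) : GA n := ∑ p ∈ labG row Finset.univ, MonoidAlgebra.single p (1:ℝ)
noncomputable def bE {n : ℕ} (col : Fin n → ℕ) : GA n :=
  ∑ q ∈ labG col Finset.univ, MonoidAlgebra.single q ((sign q : ℤ) : ℝ)

lemma coeff_axb {n : ℕ} (row col : Fin n → ℕ) (x : GA n) :
    (aE row * x * bE col).coeff 1 = ySum row col Finset.univ (fun g => x.coeff g) := by
  unfold aE bE ySum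
  rw [Finset.sum_mul, Finset.sum_mul_sum]
  simp only [MonoidAlgebra.coeff_sum, Finsupp.finsetSum_apply, coeff_smm]
  rw [← labG_sum_inv]
  refine Finset.sum_congr rfl fun p _ => ?_
  rw [← labG_sum_inv]
  simp

lemma aE_mul {n : ℕ} (row : Fin n → ℕ) {p : Perm (Fin n)} (hp : p ∈ labG row Finset.univ) :
    aE row * MonoidAlgebra.single p (1:ℝ) = aE row := by
  unfold aE
  rw [Finset.sum_mul]
  refine Finset.sum_nbij' (fun x => x * p) (fun x => x * p⁻¹) ?_ ?_ ?_ ?_ ?_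
  · intro x hx; exact labG_mul hx hp
  · intro x hx; exact labG_mul hx (labG_inv hp)
  all_goals intro x _; simp [MonoidAlgebra.single_mul_single]

lemma bE_mul {n : ℕ} (col : Fin n → ℕ) {q : Perm (Fin n)} (hq : q ∈ labG col Finset.univ) :
    MonoidAlgebra.single q (1:ℝ) * bE col = ((sign q : ℤ) : ℝ) • bE col := by
  unfold bE
  rw [Finset.mul_sum, Finset.smul_sum]
  refine Finset.sum_nbij' (fun x => q * x) (fun x => q⁻¹ * x) ?_ ?_ ?_ ?_ ?_
  · intro x hx; exact labG_mul hq hx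
  · intro x hx; exact labG_mul (labG_inv hq) hx
  · intro x _; simp
  · intro x _; simp
  · intro x _
    rw [MonoidAlgebra.single_mul_single, MonoidAlgebra.smul_single]
    congr 1
    rw [Perm.sign_mul]
    rcases Int.units_eq_one_or (sign q) with h | h <;> simp [h]

lemma vn_alg {n : ℕ} (row col : Fin n → ℕ) (hl : IsLow row col Finset.univ) (g : Perm (Fin n)) :
    ∃ c : ℝ, aE row * MonoidAlgebra.single g (1:ℝ) * bE col = c • (aE row * bE col) := by
  by_cases h : ∀ i j, row i = row j → col (g⁻¹ i) = col (g⁻¹ j) → i = j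
  · obtain ⟨p, hp, q, hq, rfl⟩ := vn_comb row col hl g h
    refine ⟨((sign q : ℤ) : ℝ), ?_⟩
    have : MonoidAlgebra.single (p * q) (1:ℝ) = MonoidAlgebra.single p (1:ℝ) * MonoidAlgebra.single q (1:ℝ) := by
      simp [MonoidAlgebra.single_mul_single]
    rw [this, ← mul_assoc, aE_mul row hp, mul_assoc, bE_mul col hq, mul_smul_comm]
  · push Not at h
    obtain ⟨i, j, hij, hc, hne⟩ := h
    refine ⟨0, ?_⟩
    have h1 : aE row * MonoidAlgebra.single (swap i j) (1:ℝ) = aE row :=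
      aE_mul row (labG_swap (Finset.mem_univ _) (Finset.mem_univ _) hij)
    have h2 := bE_mul col (labG_swap (Finset.mem_univ _) (Finset.mem_univ _) hc)
    have hne' : g⁻¹ i ≠ g⁻¹ j := fun h => hne (g⁻¹.injective h)
    have h3 : MonoidAlgebra.single (swap i j) (1:ℝ) * MonoidAlgebra.single g (1:ℝ) =
        MonoidAlgebra.single g (1:ℝ) * MonoidAlgebra.single (swap (g⁻¹ i) (g⁻¹ j)) (1:ℝ) := by
      rw [MonoidAlgebra.single_mul_single, MonoidAlgebra.single_mul_single, Equiv.mul_swap_eq_swap_mul]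
      rw [show g (g⁻¹ i) = i from g.apply_symm_apply i, show g (g⁻¹ j) = j from g.apply_symm_apply j]
    rw [sign_swap hne'] at h2
    have h4 : aE row * MonoidAlgebra.single g (1:ℝ) * bE col = - (aE row * MonoidAlgebra.single g (1:ℝ) * bE col) := by
      conv_lhs => rw [← h1, mul_assoc (aE row), h3, ← mul_assoc, mul_assoc _ _ (bE col), h2]
      simp
    rw [zero_smul]
    have h5 : (2:ℝ) • (aE row * MonoidAlgebra.single g (1:ℝ) * bE col) = 0 := by
      rw [two_smul]; nth_rewrite 1 [h4]; simp
    exact (smul_eq_zero.1 h5).resolve_left two_ne_zero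

lemma v_coeff_one {n : ℕ} (row col : Fin n → ℕ) (hl : IsLow row col Finset.univ) :
    (aE row * bE col).coeff 1 = 1 := by
  have h := coeff_axb row col (1 : GA n)
  rw [mul_one] at h
  rw [h]
  unfold ySum
  rw [Finset.sum_eq_single_of_mem 1 labG_one, Finset.sum_eq_single_of_mem 1 labG_one]
  · simp [MonoidAlgebra.one_def]
  · intro q hq hne
    simp [MonoidAlgebra.one_def, Finsupp.single_apply, hne.symm]
  · intro p hp hne
    apply Finset.sum_eq_zero
    intro q hq
    have : ¬ (1 = p * q) := by
      intro h
      have hpq : p = q⁻¹ := eq_inv_of_mul_eq_one_left h.symm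
      apply hne
      ext x
      have h1 := (mem_labG.1 hp).1 x
      have h2 := (mem_labG.1 (labG_inv hq)).1 x
      rw [← hpq] at h2
      rw [hl.inj _ _ h1 h2]; rfl
    simp [MonoidAlgebra.one_def, Finsupp.single_apply, this]

lemma central_mul_v {n : ℕ} (row col : Fin n → ℕ) (hl : IsLow row col Finset.univ) (z : GA n)
    (hz : ∀ x : GA n, x * z = z * x) :
    z * (aE row * bE col) = ySum row col Finset.univ (fun g => z.coeff g) • (aE row * bE col) := by
  choose c hc using vn_alg row col hl
  have h1 : z * (aE row * bE col) = (∑ g, z.coeff g * c g) • (aE row * bE col) := by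
    have hz' : z = ∑ g, z.coeff g • MonoidAlgebra.single g (1:ℝ) := by rw [← toA_eq, toA_of_coeff]
    rw [← mul_assoc, ← hz]
    conv_lhs => rw [hz']
    rw [Finset.mul_sum, Finset.sum_mul, Finset.sum_smul]
    refine Finset.sum_congr rfl fun g _ => ?_
    rw [mul_smul_comm, smul_mul_assoc, hc, smul_smul]
  have h2 := coeff_axb row col z
  rw [hz, mul_assoc, h1] at h2
  rw [h1]
  congr 1
  rw [← h2]
  simp [v_coeff_one row col hl]

end

section
open Equiv Equiv.Perm

abbrev Yd (n : ℕ) := {μ : YoungDiagram // μ.card = n}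

lemma yd_bound (μ : YoungDiagram) {c : ℕ × ℕ} (hc : c ∈ μ) : c.1 < μ.card ∧ c.2 < μ.card := by
  constructor
  · have : (Finset.range (c.1+1)).image (fun i => (i, c.2)) ⊆ μ.cells := by
      intro x hx
      simp only [Finset.mem_image, Finset.mem_range] at hx
      obtain ⟨i, hi, rfl⟩ := hx
      exact μ.up_left_mem (i2 := c.1) (j2 := c.2) (by omega) le_rfl hc
    have := Finset.card_le_card this
    rw [Finset.card_image_of_injective _ (fun a b h => by simpa using h)] at this
    simpa using this
  · have : (Finset.range (c.2+1)).image (fun i => (c.1, i)) ⊆ μ.cells := by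
      intro x hx
      simp only [Finset.mem_image, Finset.mem_range] at hx
      obtain ⟨i, hi, rfl⟩ := hx
      exact μ.up_left_mem (i2 := c.1) (j2 := c.2) le_rfl (by omega) hc
    have := Finset.card_le_card this
    rw [Finset.card_image_of_injective _ (fun a b h => by simpa using h)] at this
    simpa using this

instance (n : ℕ) : Finite (Yd n) := by
  let f : Yd n → (Finset.range n ×ˢ Finset.range n).powerset := fun μ => ⟨μ.1.cells, by
    rw [Finset.mem_powerset]
    intro c hc
    have := yd_bound μ.1 (c := c) hc
    rw [μ.2] at this
    simpa using this⟩
  refine Finite.of_injective f ?_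
  intro a b h
  apply Subtype.ext
  apply YoungDiagram.ext
  simpa [f] using h

noncomputable instance (n : ℕ) : Fintype (Yd n) := Fintype.ofFinite _

lemma card_cellsOf (w : List ℕ) : (YoungDiagram.cellsOfRowLens w).card = w.sum := by
  induction w with
  | nil => simp [YoungDiagram.cellsOfRowLens]
  | cons a w ih =>
    rw [YoungDiagram.cellsOfRowLens, Finset.card_union_of_disjoint]
    · simp [ih]
    · rw [Finset.disjoint_left]
      rintro ⟨i, j⟩ h1 h2
      simp at h1 h2
      omega

lemma card_part_le (n : ℕ) : Fintype.card (Nat.Partition n) ≤ Fintype.card (Yd n) := by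
  refine Fintype.card_le_of_injective (fun p => ⟨YoungDiagram.ofRowLens (p.parts.sort (· ≥ ·))
      ((Multiset.pairwise_sort p.parts (· ≥ ·)).sortedGE), ?_⟩) ?_
  · have h := card_cellsOf (p.parts.sort (· ≥ ·))
    rw [← Multiset.sum_coe, Multiset.sort_eq, p.parts_sum] at h
    exact h
  · intro p q h
    have h1 := congrArg YoungDiagram.rowLens (congrArg Subtype.val h)
    simp only at h1
    rw [YoungDiagram.rowLens_ofRowLens_eq_self, YoungDiagram.rowLens_ofRowLens_eq_self] at h1
    · apply Nat.Partition.ext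
      rw [← Multiset.sort_eq p.parts (· ≥ ·), h1, Multiset.sort_eq]
    · intro x hx; exact q.parts_pos ((Multiset.mem_sort _).1 hx)
    · intro x hx; exact p.parts_pos ((Multiset.mem_sort _).1 hx)

noncomputable def ydE {n : ℕ} (μ : Yd n) : Fin n ≃ {c // c ∈ μ.1.cells} :=
  (finCongr μ.2.symm).trans (Finset.equivFin _).symm

noncomputable def rw' {n : ℕ} (μ : Yd n) (e : Fin n) : ℕ := (ydE μ e).1.1
noncomputable def cl' {n : ℕ} (μ : Yd n) (e : Fin n) : ℕ := (ydE μ e).1.2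

lemma yd_low {n : ℕ} (μ : Yd n) : IsLow (rw' μ) (cl' μ) Finset.univ where
  inj x y h1 h2 := by
    apply (ydE μ).injective
    apply Subtype.ext
    exact Prod.ext h1 h2
  low x _ i j hi hj := by
    have : (i, j) ∈ μ.1.cells := μ.1.up_left_mem hi hj (ydE μ x).2
    refine ⟨(ydE μ).symm ⟨(i,j), this⟩, Finset.mem_univ _, ?_, ?_⟩ <;> simp [rw', cl']

lemma yd_sum {M : Type*} [AddCommMonoid M] {n : ℕ} (μ : Yd n) (F : ℕ → ℕ → M) :
    ∑ e, F (rw' μ e) (cl' μ e) = ∑ c ∈ μ.1.cells, F c.1 c.2 := by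
  rw [← Finset.sum_coe_sort μ.1.cells, ← Equiv.sum_comp (ydE μ)]
  rfl
lemma yd_prod {M : Type*} [CommMonoid M] {n : ℕ} (μ : Yd n) (F : ℕ → ℕ → M) :
    ∏ e, F (rw' μ e) (cl' μ e) = ∏ c ∈ μ.1.cells, F c.1 c.2 := by
  rw [← Finset.prod_coe_sort μ.1.cells, ← Equiv.prod_comp (ydE μ)]
  rfl

lemma yd_sub (μ ν : YoungDiagram) (h : ∀ t : ℝ, (μ.cells.filter (fun c => (c.1 : ℝ) - c.2 = t)).card =
    (ν.cells.filter (fun c => (c.1 : ℝ) - c.2 = t)).card) : μ.cells ⊆ ν.cells := by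
  intro x hx
  by_contra hn
  have hss : ν.cells.filter (fun c => (c.1 : ℝ) - c.2 = x.1 - x.2) ⊂ μ.cells.filter (fun c => (c.1 : ℝ) - c.2 = x.1 - x.2) := by
    rw [Finset.ssubset_iff_of_subset]
    · exact ⟨x, by simpa using hx, by simp; intro h; exact absurd h hn⟩
    · intro y hy
      rw [Finset.mem_filter] at hy ⊢
      refine ⟨?_, hy.2⟩
      have h1 : (y.1 : ℝ) + x.2 = x.1 + y.2 := by linarith [hy.2]
      have h1 : y.1 + x.2 = x.1 + y.2 := by exact_mod_cast h1
      by_cases hc : x.1 ≤ y.1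
      · exact absurd (ν.up_left_mem hc (by omega : x.2 ≤ y.2) hy.1) hn
      · exact μ.up_left_mem (by omega : y.1 ≤ x.1) (by omega : y.2 ≤ x.2) hx
  have := Finset.card_lt_card hss
  rw [h] at this
  exact lt_irrefl _ this

lemma yd_inj {n : ℕ} (μ ν : Yd n) (h : ∀ x : ℝ, x ≠ 0 → ∏ e, (x + cl' μ e - rw' μ e) = ∏ e, (x + cl' ν e - rw' ν e)) : μ = ν := by
  have hp : ∀ (μ : Yd n) (x : ℝ), ∏ e, (x + cl' μ e - rw' μ e) =
      Polynomial.eval x ((μ.1.cells.val.map (fun c => (c.1 : ℝ) - c.2)).map (fun a => Polynomial.X - Polynomial.C a)).prod := by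
    intro μ x
    rw [yd_prod μ (fun i j => x + (j:ℝ) - i)]
    rw [Multiset.map_map]
    change _ = Polynomial.eval x (∏ c ∈ μ.1.cells, _)
    rw [Polynomial.eval_prod]
    refine Finset.prod_congr rfl fun c _ => ?_
    simp; ring
  have h2 := Polynomial.eq_of_infinite_eval_eq
    ((μ.1.cells.val.map (fun c => (c.1 : ℝ) - c.2)).map (fun a => Polynomial.X - Polynomial.C a)).prod
    ((ν.1.cells.val.map (fun c => (c.1 : ℝ) - c.2)).map (fun a => Polynomial.X - Polynomial.C a)).prod
    ((Set.Ioi_infinite (0:ℝ)).mono (fun x hx => by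
      rw [Set.mem_ofPred_eq, ← hp, ← hp]; exact h x (ne_of_gt hx)))
  have h3 := congrArg Polynomial.roots h2
  rw [Polynomial.roots_multiset_prod_X_sub_C, Polynomial.roots_multiset_prod_X_sub_C] at h3
  have h4 : ∀ t : ℝ, (μ.1.cells.filter (fun c => (c.1 : ℝ) - c.2 = t)).card =
    (ν.1.cells.filter (fun c => (c.1 : ℝ) - c.2 = t)).card := by
    intro t
    have := congrArg (Multiset.count t) h3
    rw [Multiset.count_map, Multiset.count_map] at this
    simp only [eq_comm (a := t)] at this
    exact this
  apply Subtype.ext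
  apply YoungDiagram.ext
  exact (yd_sub _ _ h4).antisymm (yd_sub _ _ (fun t => (h4 t).symm))

end

section
open Equiv Equiv.Perm

noncomputable def om {n : ℕ} (μ : Yd n) : GA n →ₗ[ℝ] ℝ where
  toFun z := ySum (rw' μ) (cl' μ) Finset.univ (fun g => z.coeff g)
  map_add' x y := by simp [ySum, mul_add, Finset.sum_add_distrib]
  map_smul' c x := by
    simp only [ySum, Finset.mul_sum, smul_eq_mul, RingHom.id_apply]
    refine Finset.sum_congr rfl fun p _ => Finset.sum_congr rfl fun q _ => ?_
    simp; ring

noncomputable def vE {n : ℕ} (μ : Yd n) : GA n := aE (rw' μ) * bE (cl' μ)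

lemma vE_one {n : ℕ} (μ : Yd n) : (vE μ).coeff 1 = 1 := v_coeff_one _ _ (yd_low μ)

lemma vE_ne {n : ℕ} (μ : Yd n) : vE μ ≠ 0 := by
  intro h
  have := vE_one μ
  rw [h] at this
  simp at this

lemma om_spec {n : ℕ} (μ : Yd n) (z : GA n) (hz : ∀ x : GA n, x * z = z * x) :
    z * vE μ = om μ z • vE μ := central_mul_v _ _ (yd_low μ) z hz

lemma om_unique {n : ℕ} (μ : Yd n) (z : GA n) (hz : ∀ x : GA n, x * z = z * x) (c : ℝ)
    (h : z * vE μ = c • vE μ) : om μ z = c := by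
  rw [om_spec μ z hz] at h
  exact smul_left_injective ℝ (vE_ne μ) h

lemma om_one {n : ℕ} (μ : Yd n) : om μ 1 = 1 := om_unique μ 1 (by simp) 1 (by simp)

lemma om_mul {n : ℕ} (μ : Yd n) (y z : GA n) (hy : ∀ x : GA n, x * y = y * x)
    (hz : ∀ x : GA n, x * z = z * x) : om μ (y * z) = om μ y * om μ z := by
  apply om_unique
  · intro x; rw [← mul_assoc, hy, mul_assoc, hz, mul_assoc]
  · rw [mul_assoc, om_spec μ z hz, mul_smul_comm, om_spec μ y hy, smul_smul, mul_comm]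

noncomputable def omH {n : ℕ} (μ : Yd n) : Submonoid.center (GA n) →* ℝ where
  toFun z := om μ z.1
  map_one' := om_one μ
  map_mul' y z := om_mul μ _ _ (Submonoid.mem_center_iff.1 y.2) (Submonoid.mem_center_iff.1 z.2)

lemma isCl_nc {n : ℕ} (F : ℕ → ℝ) : IsCl (fun g : Perm (Fin n) => F (numCycles g)) := by
  intro g h; simp only [nc_comm]

lemma om_pow {n : ℕ} (μ : Yd n) (x : ℝ) (hx : x ≠ 0) :
    om μ (toA (fun g => x ^ numCycles g)) = ∏ e, (x + cl' μ e - rw' μ e) :=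
  ySum_univ _ _ x hx (yd_low μ)

lemma omH_inj {n : ℕ} : Function.Injective (omH (n := n)) := by
  intro μ ν h
  apply yd_inj
  intro x hx
  rw [← om_pow μ x hx, ← om_pow ν x hx]
  exact DFunLike.congr_fun h ⟨toA (fun g => x ^ numCycles g), Submonoid.mem_center_iff.2
    (toA_central (isCl_nc _))⟩

noncomputable def OmL (n : ℕ) : Subalgebra.center ℝ (GA n) →ₗ[ℝ] (Yd n → ℝ) :=
  LinearMap.pi (fun μ => (om μ).comp (Subalgebra.center ℝ (GA n)).val.toLinearMap)

lemma OmL_surj (n : ℕ) : Function.Surjective (OmL n) := by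
  classical
  rw [← LinearMap.range_eq_top]
  by_contra hne
  obtain ⟨φ, hφ, hk⟩ := Submodule.exists_le_ker_of_lt_top _ (lt_top_iff_ne_top.2 hne)
  have hli := (linearIndependent_monoidHom (Submonoid.center (GA n)) ℝ).comp _ (omH_inj (n := n))
  rw [Fintype.linearIndependent_iff] at hli
  have h0 := hli (fun μ => φ (fun ν => if μ = ν then 1 else 0)) (by
    ext z
    have hz : (⟨z.1, Subalgebra.mem_center_iff.2 (Submonoid.mem_center_iff.1 z.2)⟩ : Subalgebra.center ℝ (GA n)) ∈ (⊤ : Submodule ℝ _) := trivial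
    have h1 : φ (OmL n ⟨z.1, Subalgebra.mem_center_iff.2 (Submonoid.mem_center_iff.1 z.2)⟩) = 0 :=
      hk (LinearMap.mem_range_self _ _)
    rw [LinearMap.pi_apply_eq_sum_univ] at h1
    rw [Finset.sum_apply]
    simp only [Pi.zero_apply]
    refine Eq.trans ?_ h1
    refine Finset.sum_congr rfl fun μ _ => ?_
    simp only [Pi.smul_apply, smul_eq_mul]
    rw [mul_comm]
    rfl)
  apply hφ
  ext μ
  have := h0 μ
  simp only [LinearMap.coe_comp, Function.comp_apply, LinearMap.zero_apply, LinearMap.coe_single]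
  rw [← this]
  congr 1
  ext ν
  simp [Pi.single_apply, eq_comm]

lemma central_coeff {n : ℕ} (z : GA n) (hz : ∀ x : GA n, x * z = z * x) : IsCl (fun g => z.coeff g) := by
  intro g h
  have := congrArg (fun y => y.coeff h) (hz (MonoidAlgebra.single g⁻¹ 1))
  simpa using this

lemma isCl_conj {n : ℕ} {f : Perm (Fin n) → ℝ} (hf : IsCl f) {g h : Perm (Fin n)} (hc : IsConj g h) : f g = f h := by
  obtain ⟨c, rfl⟩ := isConj_iff.1 hc
  rw [hf, ← mul_assoc]; simp

lemma ga_rank_le (n : ℕ) : Module.finrank ℝ (Subalgebra.center ℝ (GA n)) ≤ Fintype.card (Yd n) := by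
  refine le_trans ?_ (card_part_le n)
  let rep : (Fintype.card (Fin n)).Partition → Perm (Fin n) := Function.invFun Equiv.Perm.partition
  have hrep : ∀ g : Perm (Fin n), IsConj (rep g.partition) g := fun g => by
    rw [Equiv.Perm.partition_eq_of_isConj]; exact Function.invFun_eq ⟨g, rfl⟩
  let A : Subalgebra.center ℝ (GA n) →ₗ[ℝ] ((Fintype.card (Fin n)).Partition → ℝ) :=
    { toFun := fun z p => z.1.coeff (rep p)
      map_add' := fun x y => by ext; simp
      map_smul' := fun x y => by ext; simp }
  have hA : Function.Injective A := by
    intro y z h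
    apply Subtype.ext
    ext g
    have h1 := congrFun h g.partition
    have hy := isCl_conj (central_coeff y.1 (Subalgebra.mem_center_iff.1 y.2)) (hrep g)
    have hz := isCl_conj (central_coeff z.1 (Subalgebra.mem_center_iff.1 z.2)) (hrep g)
    exact hy.symm.trans (h1.trans hz)
  have := LinearMap.finrank_le_finrank_of_injective hA
  rw [Module.finrank_fintype_fun_eq_card] at this
  refine this.trans (le_of_eq ?_)
  rw [Fintype.card_fin]

lemma OmL_inj (n : ℕ) : Function.Injective (OmL n) := by
  have h1 := LinearMap.finrank_le_finrank_of_surjective (OmL_surj n)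
  rw [Module.finrank_fintype_fun_eq_card] at h1
  have h2 := le_antisymm (ga_rank_le n) h1
  exact (LinearMap.injective_iff_surjective_of_finrank_eq_finrank
    (by rw [h2, Module.finrank_fintype_fun_eq_card])).2 (OmL_surj n)

lemma Om_ext {n : ℕ} (y z : GA n) (hy : ∀ x : GA n, x * y = y * x) (hz : ∀ x : GA n, x * z = z * x)
    (h : ∀ μ, om μ y = om μ z) : y = z := by
  have := OmL_inj n (a₁ := ⟨y, Subalgebra.mem_center_iff.2 hy⟩) (a₂ := ⟨z, Subalgebra.mem_center_iff.2 hz⟩)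
    (by ext μ; exact h μ)
  exact congrArg Subtype.val this

lemma idem_exists (n : ℕ) : ∃ e : Yd n → GA n, (∀ μ, ∀ x : GA n, x * e μ = e μ * x) ∧ (∀ μ, om μ (e μ) = 1) ∧
    ∀ y : GA n, (∀ x : GA n, x * y = y * x) → y = ∑ μ, om μ y • e μ := by
  classical
  choose e he using fun μ : Yd n => OmL_surj n (Pi.single μ 1)
  have hc : ∀ μ, ∀ x : GA n, x * (e μ).1 = (e μ).1 * x := fun μ => Subalgebra.mem_center_iff.1 (e μ).2
  refine ⟨fun μ => (e μ).1, hc, fun μ => (congrFun (he μ) μ).trans (by simp), ?_⟩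
  intro y hy
  apply Om_ext _ _ hy
  · intro x; rw [Finset.mul_sum, Finset.sum_mul]
    refine Finset.sum_congr rfl fun μ _ => ?_
    rw [mul_smul_comm, smul_mul_assoc, hc]
  · intro ν
    rw [map_sum]
    have : ∀ μ, om ν (e μ).1 = (Pi.single μ 1 : Yd n → ℝ) ν := fun μ => congrFun (he μ) ν
    simp [this, Pi.single_apply]

noncomputable def avg (n : ℕ) : GA n →ₗ[ℝ] GA n where
  toFun x := ∑ a : Perm (Fin n), MonoidAlgebra.single a (1:ℝ) * x * MonoidAlgebra.single a⁻¹ (1:ℝ)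
  map_add' x y := by simp only [mul_add, add_mul, Finset.sum_add_distrib]
  map_smul' c x := by simp only [mul_smul_comm, smul_mul_assoc, Finset.smul_sum, RingHom.id_apply]

lemma avg_coeff {n : ℕ} (x : GA n) (g : Perm (Fin n)) : (avg n x).coeff g = ∑ a, x.coeff (a⁻¹ * g * a) := by
  simp only [avg, LinearMap.coe_mk, AddHom.coe_mk, MonoidAlgebra.coeff_sum, Finsupp.finsetSum_apply, coeff_smm]
  simp

lemma avg_central {n : ℕ} (x : GA n) (y : GA n) : y * avg n x = avg n x * y := by
  have : IsCl (fun g => (avg n x).coeff g) := by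
    intro g h
    simp only [avg_coeff]
    rw [← Equiv.sum_comp (Equiv.mulLeft g)]
    refine Finset.sum_congr rfl fun a _ => ?_
    congr 1
    simp [mul_assoc]
  rw [← toA_of_coeff (avg n x)]
  exact toA_central this y

lemma avg_of_central {n : ℕ} (z : GA n) (hz : ∀ x : GA n, x * z = z * x) : avg n z = (n.factorial : ℝ) • z := by
  have : ∀ a : Perm (Fin n), MonoidAlgebra.single a (1:ℝ) * z * MonoidAlgebra.single a⁻¹ (1:ℝ) = z := by
    intro a
    rw [hz, mul_assoc, MonoidAlgebra.single_mul_single]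
    simp [← MonoidAlgebra.one_def]
  simp only [avg, LinearMap.coe_mk, AddHom.coe_mk, this]
  simp [Fintype.card_perm, ← Nat.cast_smul_eq_nsmul ℝ]

lemma trace_formula {n : ℕ} (z : GA n) (hz : ∀ x : GA n, x * z = z * x) :
    ∑ g : Perm (Fin n), ∑ a : Perm (Fin n), z.coeff (g * a * g⁻¹ * a⁻¹) = (n.factorial : ℝ) * ∑ μ, om μ z := by
  obtain ⟨e, hec, he1, he⟩ := idem_exists n
  have hL : ∀ g : Perm (Fin n), ∑ a : Perm (Fin n), z.coeff (g * a * g⁻¹ * a⁻¹) =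
      (z * avg n (MonoidAlgebra.single g 1)).coeff g := by
    intro g
    simp only [avg, LinearMap.coe_mk, AddHom.coe_mk, Finset.mul_sum, MonoidAlgebra.single_mul_single, MonoidAlgebra.coeff_sum, Finsupp.finsetSum_apply]
    refine Finset.sum_congr rfl fun a _ => ?_
    simp [mul_assoc]
  have hcm : ∀ g : Perm (Fin n), ∀ x : GA n, x * (z * avg n (MonoidAlgebra.single g 1)) = (z * avg n (MonoidAlgebra.single g 1)) * x := by
    intro g x
    rw [← mul_assoc, hz, mul_assoc, avg_central, mul_assoc]
  have hR : ∀ g : Perm (Fin n), (z * avg n (MonoidAlgebra.single g 1)).coeff g =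
      ∑ μ, om μ z * (om μ (avg n (MonoidAlgebra.single g 1)) * (e μ).coeff g) := by
    intro g
    rw [he _ (hcm g)]
    simp only [MonoidAlgebra.coeff_sum, Finsupp.finsetSum_apply, MonoidAlgebra.coeff_smul, Finsupp.smul_apply, smul_eq_mul]
    refine Finset.sum_congr rfl fun μ _ => ?_
    rw [om_mul μ _ _ hz (avg_central _), mul_assoc]
  rw [Finset.sum_congr rfl (fun g _ => (hL g).trans (hR g)), Finset.sum_comm, Finset.mul_sum]
  refine Finset.sum_congr rfl fun μ _ => ?_
  rw [← Finset.mul_sum, mul_comm]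
  congr 1
  have h1 : ∑ g, om μ (avg n (MonoidAlgebra.single g 1)) * (e μ).coeff g = om μ (avg n (e μ)) := by
    have : e μ = ∑ g, (e μ).coeff g • MonoidAlgebra.single g (1:ℝ) := by rw [← toA_eq, toA_of_coeff]
    conv_rhs => rw [this]
    rw [map_sum, map_sum]
    refine Finset.sum_congr rfl fun g _ => ?_
    rw [map_smul, map_smul, smul_eq_mul, mul_comm]
  rw [h1, avg_of_central _ (hec μ), map_smul, smul_eq_mul, he1, mul_one]

end

section
open Equiv Equiv.Perm

noncomputable def Hop {n : ℕ} (f : Perm (Fin n) → ℝ) (g : Perm (Fin n)) : ℝ :=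
  (∑ a : Perm (Fin n), ∑ b : Perm (Fin n), f (a * b * a⁻¹ * b⁻¹ * g)) / (n.factorial : ℝ) ^ 2

noncomputable def pE (n : ℕ) : GA n :=
  ((n.factorial : ℝ) ^ 2)⁻¹ • ∑ a : Perm (Fin n), ∑ b : Perm (Fin n), MonoidAlgebra.single (a * b * a⁻¹ * b⁻¹) (1:ℝ)

lemma pE_mul_coeff {n : ℕ} (z : GA n) (g : Perm (Fin n)) : (pE n * z).coeff g = Hop (fun h => z.coeff h) g := by
  unfold pE Hop
  rw [smul_mul_assoc, Finset.sum_mul]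
  simp only [Finset.sum_mul, MonoidAlgebra.coeff_smul, MonoidAlgebra.coeff_sum, Finsupp.smul_apply, Finsupp.finsetSum_apply, smul_eq_mul]
  rw [div_eq_inv_mul, Finset.sum_comm]
  congr 1
  refine Finset.sum_congr rfl fun a _ => Finset.sum_congr rfl fun b _ => ?_
  simp [mul_assoc]

lemma toA_Hop {n : ℕ} (f : Perm (Fin n) → ℝ) : toA (Hop f) = pE n * toA f := by
  ext g
  rw [pE_mul_coeff]; rfl

lemma Hop_cl {n : ℕ} {f : Perm (Fin n) → ℝ} (hf : IsCl f) : IsCl (Hop f) := by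
  intro g h
  unfold Hop
  congr 1
  rw [← Equiv.sum_comp (MulAut.conj g).toEquiv]
  refine Finset.sum_congr rfl fun a _ => ?_
  rw [← Equiv.sum_comp (MulAut.conj g).toEquiv]
  refine Finset.sum_congr rfl fun b _ => ?_
  simp only [MulEquiv.toEquiv_eq_coe, MulEquiv.coe_toEquiv, MulAut.conj_apply]
  rw [show g * a * g⁻¹ * (g * b * g⁻¹) * (g * a * g⁻¹)⁻¹ * (g * b * g⁻¹)⁻¹ * (g * h) = g * (a * b * a⁻¹ * b⁻¹ * h) by group]
  rw [hf g]
  simp [mul_assoc]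

lemma pE_central {n : ℕ} (x : GA n) : x * pE n = pE n * x := by
  have h1 : toA (Hop (fun h => (1 : GA n).coeff h)) = pE n := by
    rw [toA_Hop, toA_of_coeff, mul_one]
  rw [← h1]
  exact toA_central (Hop_cl (central_coeff 1 (by simp))) x

lemma fac_pos (n : ℕ) : (0:ℝ) < n.factorial := by exact_mod_cast n.factorial_pos

lemma pE_mul_one {n : ℕ} (z : GA n) (hz : ∀ x : GA n, x * z = z * x) :
    (pE n * z).coeff 1 = (∑ μ, om μ z) / n.factorial := by
  rw [pE_mul_coeff]
  unfold Hop
  simp only [mul_one]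
  rw [trace_formula z hz]
  have := fac_pos n
  field_simp

lemma om_pE_le {n : ℕ} (μ : Yd n) : |om μ (pE n)| ≤ 1 := by
  set v := vE μ with hv
  have hN := fac_pos n
  have hpos : 0 < ∑ g, |v.coeff g| := by
    refine lt_of_lt_of_le one_pos ?_
    calc (1:ℝ) = |v.coeff 1| := by rw [hv, vE_one]; simp
      _ ≤ _ := Finset.single_le_sum (f := fun g => |v.coeff g|) (fun _ _ => abs_nonneg _) (Finset.mem_univ _)
  have h1 : |om μ (pE n)| * ∑ g, |v.coeff g| ≤ 1 * ∑ g, |v.coeff g| := by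
    calc |om μ (pE n)| * ∑ g, |v.coeff g| = ∑ g, |(pE n * v).coeff g| := by
          rw [om_spec μ _ pE_central, Finset.mul_sum]
          refine Finset.sum_congr rfl fun g _ => ?_
          simp [abs_mul, hv]
      _ ≤ ∑ g, (∑ a : Perm (Fin n), ∑ b : Perm (Fin n), |v.coeff (a * b * a⁻¹ * b⁻¹ * g)|) / (n.factorial : ℝ) ^ 2 := by
          refine Finset.sum_le_sum fun g _ => ?_
          rw [pE_mul_coeff]
          unfold Hop
          rw [abs_div, abs_of_pos (by positivity : (0:ℝ) < (n.factorial:ℝ)^2)]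
          gcongr
          refine (Finset.abs_sum_le_sum_abs _ _).trans (Finset.sum_le_sum fun a _ => Finset.abs_sum_le_sum_abs _ _)
      _ = 1 * ∑ g, |v.coeff g| := by
          rw [← Finset.sum_div, Finset.sum_comm]
          have : ∀ a : Perm (Fin n), ∑ g, ∑ b : Perm (Fin n), |v.coeff (a * b * a⁻¹ * b⁻¹ * g)| = n.factorial * ∑ g, |v.coeff g| := by
            intro a
            rw [Finset.sum_comm]
            have h3 : ∀ b : Perm (Fin n), ∑ g, |v.coeff (a * b * a⁻¹ * b⁻¹ * g)| = ∑ g, |v.coeff g| :=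
              fun b => Equiv.sum_comp (Equiv.mulLeft (a * b * a⁻¹ * b⁻¹)) (fun g => |v.coeff g|)
            rw [Finset.sum_congr rfl (fun b _ => h3 b)]
            simp [Fintype.card_perm]
          rw [Finset.sum_congr rfl (fun a _ => this a)]
          simp only [Finset.sum_const, Finset.card_univ, Fintype.card_perm, Fintype.card_fin, nsmul_eq_mul]
          field_simp
  exact le_of_mul_le_mul_right h1 hpos

def wd {n k : ℕ} (v : Fin k → Perm (Fin n)) : Perm (Fin n) :=
  (List.ofFn v).prod * (List.ofFn fun i => (v i)⁻¹).prod

lemma two_step {n : ℕ} {f : Perm (Fin n) → ℝ} (hf : IsCl f) (g X Y : Perm (Fin n)) :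
    ∑ a, ∑ b, f (g * (a * (b * X) * (a⁻¹ * (b⁻¹ * Y)))) = (n.factorial : ℝ) ^ 2 * Hop f (g * (X * Y)) := by
  have hN := fac_pos n
  have h1 : ∀ a, ∑ b, f (g * (a * (b * X) * (a⁻¹ * (b⁻¹ * Y)))) =
      ∑ b, f (g * (a * b * a⁻¹ * X * b⁻¹ * Y)) := by
    intro a
    rw [← Equiv.sum_comp (Equiv.mulRight X⁻¹)]
    refine Finset.sum_congr rfl fun b _ => ?_
    simp [mul_assoc]
  rw [Finset.sum_congr rfl (fun a _ => h1 a), ← Equiv.sum_comp (Equiv.mulLeft X)]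
  rw [← mul_assoc, Hop_cl hf]
  unfold Hop
  rw [mul_div_cancel₀ _ (by positivity)]
  refine Finset.sum_congr rfl fun a _ => Finset.sum_congr rfl fun b _ => ?_
  rw [show g * ((Equiv.mulLeft X) a * b * ((Equiv.mulLeft X) a)⁻¹ * X * b⁻¹ * Y) = (g * X) * ((a * b * a⁻¹ * b⁻¹) * Y) by
    simp [mul_assoc]]
  rw [hf]
  simp [mul_assoc]

lemma sum_cons {α : Type*} [Fintype α] {k : ℕ} (F : (Fin (k+1) → α) → ℝ) :
    ∑ v, F v = ∑ a, ∑ u : Fin k → α, F (Fin.cons a u) := by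
  rw [← Fintype.sum_prod_type', ← (Fin.consEquiv (fun _ : Fin (k+1) => α)).sum_comp]
  rfl

lemma word_even {n : ℕ} (j : ℕ) : ∀ {f : Perm (Fin n) → ℝ} (_ : IsCl f) (g : Perm (Fin n)),
    ∑ v : Fin (2 * j) → Perm (Fin n), f (g * wd v) = ((n.factorial : ℝ) ^ 2) ^ j * (Hop^[j] f) g := by
  induction j with
  | zero => intro f hf g; simp [wd]
  | succ j ih =>
    intro f hf g
    change ∑ v : Fin (2 * j + 1 + 1) → Perm (Fin n), f (g * wd v) = _
    rw [sum_cons]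
    simp_rw [sum_cons (k := 2 * j)]
    have : ∀ a b (u : Fin (2*j) → Perm (Fin n)), wd (Fin.cons (α := fun _ => Perm (Fin n)) a (Fin.cons (α := fun _ => Perm (Fin n)) b u)) =
      a * (b * (List.ofFn u).prod) * (a⁻¹ * (b⁻¹ * (List.ofFn fun i => (u i)⁻¹).prod)) := by
      intro a b u
      simp [wd, List.ofFn_succ]
    simp_rw [this]
    have h2 : ∑ a, ∑ b, ∑ u : Fin (2*j) → Perm (Fin n), f (g * (a * (b * (List.ofFn u).prod) * (a⁻¹ * (b⁻¹ * (List.ofFn fun i => (u i)⁻¹).prod)))) =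
       ∑ u : Fin (2*j) → Perm (Fin n), ∑ a, ∑ b, f (g * (a * (b * (List.ofFn u).prod) * (a⁻¹ * (b⁻¹ * (List.ofFn fun i => (u i)⁻¹).prod)))) := by
      rw [Finset.sum_comm]
      conv_rhs => rw [Finset.sum_comm, Finset.sum_congr rfl (fun a _ => Finset.sum_comm)]
      rw [Finset.sum_comm]
    rw [h2]
    simp_rw [two_step hf]
    rw [← Finset.mul_sum]
    have := ih (Hop_cl hf) g
    unfold wd at this
    rw [this, Function.iterate_succ_apply]
    ring

lemma toA_iter {n : ℕ} (f : Perm (Fin n) → ℝ) (j : ℕ) : toA (Hop^[j] f) = pE n ^ j * toA f := by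
  induction j with
  | zero => simp
  | succ j ih => rw [Function.iterate_succ_apply', toA_Hop, ih, pow_succ', mul_assoc]

lemma cmul {n : ℕ} {y z : GA n} (hy : ∀ x : GA n, x * y = y * x)
    (hz : ∀ x : GA n, x * z = z * x) (x : GA n) : x * (y * z) = (y * z) * x := by
  rw [← mul_assoc, hy, mul_assoc, hz, mul_assoc]

lemma cpow {n : ℕ} {y : GA n} (hy : ∀ x : GA n, x * y = y * x) (j : ℕ) (x : GA n) : x * y ^ j = y ^ j * x := by
  exact (Commute.pow_right (hy x) j)

lemma om_powE {n : ℕ} (μ : Yd n) {y : GA n} (hy : ∀ x : GA n, x * y = y * x) (j : ℕ) : om μ (y ^ j) = om μ y ^ j := by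
  induction j with
  | zero => simp [om_one]
  | succ j ih => rw [pow_succ, om_mul μ _ _ (cpow hy j) hy, ih, pow_succ]

/-- even case -/
lemma even_formula {n : ℕ} (j : ℕ) {f : Perm (Fin n) → ℝ} (hf : IsCl f) :
    expectK n (2 * (j+1)) (fun v => f (wd v)) = (∑ μ, om μ (pE n) ^ j * om μ (toA f)) / n.factorial := by
  have hN := fac_pos n
  have h := word_even (j+1) hf 1
  simp only [one_mul] at h
  unfold expectK
  rw [h, pow_mul, mul_div_cancel_left₀ _ (by positivity)]
  have h2 : (Hop^[j+1] f) 1 = (toA (Hop^[j+1] f)).coeff 1 := rfl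
  rw [h2, toA_iter, pow_succ', mul_assoc, pE_mul_one _ (cmul (cpow pE_central j) (toA_central hf))]
  congr 1
  refine Finset.sum_congr rfl fun μ _ => ?_
  rw [om_mul μ _ _ (cpow pE_central j) (toA_central hf), om_powE μ pE_central]

lemma odd_sum {n : ℕ} (m : ℕ) {f1 f2 : Perm (Fin n) → ℝ} (h1 : IsCl f1) (h2 : IsCl f2) :
    ∑ v : Fin (m+1) → Perm (Fin n), f1 (List.ofFn v).prod * f2 (List.ofFn fun i => (v i)⁻¹).prod =
      ∑ d, f1 d * ∑ u : Fin m → Perm (Fin n), f2 (d⁻¹ * wd u) := by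
  rw [sum_cons, Finset.sum_comm]
  simp_rw [Finset.mul_sum]
  rw [Finset.sum_comm (s := (Finset.univ : Finset (Perm (Fin n))))]
  refine Finset.sum_congr rfl fun u _ => ?_
  rw [← Equiv.sum_comp (Equiv.mulLeft (List.ofFn u).prod⁻¹)]
  refine Finset.sum_congr rfl fun s _ => ?_
  simp only [List.ofFn_succ, Fin.cons_zero, Fin.cons_succ, List.prod_cons]
  rw [h1]
  simp [wd, mul_assoc]

lemma odd_formula {n : ℕ} (j : ℕ) {f1 f2 : Perm (Fin n) → ℝ} (h1 : IsCl f1) (h2 : IsCl f2) :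
    expectK n (2 * (j+1) + 1) (fun v => f1 (List.ofFn v).prod * f2 (List.ofFn fun i => (v i)⁻¹).prod) =
      (∑ μ, om μ (pE n) ^ j * (om μ (toA f1) * om μ (toA f2))) / (n.factorial : ℝ) ^ 2 := by
  have hN := fac_pos n
  unfold expectK
  rw [odd_sum _ h1 h2]
  simp_rw [word_even (j+1) h2]
  have h3 : ∑ d, f1 d * (((n.factorial : ℝ) ^ 2) ^ (j+1) * (Hop^[j+1] f2) d⁻¹) =
      ((n.factorial : ℝ) ^ 2) ^ (j+1) * (toA f1 * toA (Hop^[j+1] f2)).coeff 1 := by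
    have : toA f1 = ∑ g, f1 g • MonoidAlgebra.single g (1:ℝ) := toA_eq _
    rw [this, Finset.sum_mul]
    simp only [MonoidAlgebra.coeff_sum, Finsupp.finsetSum_apply]
    rw [Finset.mul_sum]
    refine Finset.sum_congr rfl fun d _ => ?_
    simp
    ring
  rw [h3, toA_iter, pow_succ' (pE n), mul_assoc (pE n), ← mul_assoc, pE_central, mul_assoc]
  rw [pE_mul_one _ (cmul (toA_central h1) (cmul (cpow pE_central j) (toA_central h2)))]
  rw [pow_succ _ (2 * (j+1)), pow_mul]
  have : ∀ μ : Yd n, om μ (toA f1 * (pE n ^ j * toA f2)) = om μ (pE n) ^ j * (om μ (toA f1) * om μ (toA f2)) := by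
    intro μ
    rw [om_mul μ _ _ (toA_central h1) (cmul (cpow pE_central j) (toA_central h2)),
      om_mul μ _ _ (cpow pE_central j) (toA_central h2), om_powE μ pE_central]
    ring
  simp_rw [this]
  field_simp

lemma marg_A {n : ℕ} (m : ℕ) {f : Perm (Fin n) → ℝ} (hf : IsCl f) :
    expectK n (m + 1) (fun v => f (List.ofFn v).prod) = (∑ g, f g) / n.factorial := by
  have hN := fac_pos n
  have h := odd_sum m hf (f2 := fun _ => 1) (fun _ _ => rfl)
  simp only [mul_one] at h
  unfold expectK
  rw [h, ← Finset.sum_mul]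
  simp [Fintype.card_perm]
  rw [pow_succ]
  field_simp

lemma marg_B {n : ℕ} (m : ℕ) {f : Perm (Fin n) → ℝ} (hf : IsCl f) :
    expectK n (m + 1) (fun v => f (List.ofFn fun i => (v i)⁻¹).prod) = (∑ g, f g) / n.factorial := by
  rw [← marg_A m hf]
  unfold expectK
  congr 1
  exact Equiv.sum_comp (Equiv.inv (Fin (m+1) → Perm (Fin n))) (fun v => f (List.ofFn v).prod)

end

section
open Equiv Equiv.Perm

def rowY (n : ℕ) : YoungDiagram where
  cells := {0} ×ˢ Finset.range n
  isLowerSet := by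
    rintro ⟨a, b⟩ ⟨c, d⟩ ⟨h1, h2⟩ h
    simp at h1 h2 h ⊢
    omega

def rowD (n : ℕ) : Yd n := ⟨rowY n, by simp [YoungDiagram.card, rowY]⟩

lemma rowD_rw {n : ℕ} (e : Fin n) : rw' (rowD n) e = 0 := by
  have := (ydE (rowD n) e).2
  have h : (ydE (rowD n) e).1 ∈ ({0} ×ˢ Finset.range n : Finset (ℕ × ℕ)) := this
  rw [Finset.mem_product, Finset.mem_singleton] at h
  exact h.1

lemma om_row {n : ℕ} (z : GA n) : om (rowD n) z = ∑ g, z.coeff g := by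
  have hr : labG (rw' (rowD n)) Finset.univ = Finset.univ := by
    ext p; simp [mem_labG, rowD_rw]
  have hc : labG (cl' (rowD n)) Finset.univ = {1} := by
    ext p
    simp only [mem_labG, Finset.mem_univ, not_true_eq_false, false_imp_iff, implies_true, and_true, Finset.mem_singleton]
    constructor
    · intro h
      ext x
      rw [(yd_low (rowD n)).inj (p x) x (by simp [rowD_rw]) (h x)]; rfl
    · rintro rfl; simp
  change ySum _ _ _ _ = _
  unfold ySum
  rw [hr, hc]
  simp

lemma om_row_pE (n : ℕ) : om (rowD n) (pE n) = 1 := by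
  have hN := fac_pos n
  rw [om_row]
  unfold pE
  simp only [MonoidAlgebra.coeff_smul, MonoidAlgebra.coeff_sum, Finsupp.smul_apply, Finsupp.finsetSum_apply, smul_eq_mul]
  rw [← Finset.mul_sum, Finset.sum_comm]
  have : ∀ a : Perm (Fin n), ∑ g, ∑ b : Perm (Fin n), (MonoidAlgebra.single (a * b * a⁻¹ * b⁻¹) (1:ℝ)).coeff g = n.factorial := by
    intro a
    rw [Finset.sum_comm]
    simp [Finsupp.single_apply, Fintype.card_perm]
  rw [Finset.sum_congr rfl (fun a _ => this a)]
  simp [Fintype.card_perm]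
  field_simp

open Polynomial in
noncomputable def Pp (μ : YoungDiagram) : Polynomial ℝ := ∏ c ∈ μ.cells, (X + C ((c.2:ℝ) - c.1))

lemma om_toA {n : ℕ} (μ : Yd n) (f : Perm (Fin n) → ℝ) :
    om μ (toA f) = ∑ g, f g * om μ (MonoidAlgebra.single g 1) := by
  rw [toA_eq, map_sum]
  refine Finset.sum_congr rfl fun g _ => ?_
  rw [map_smul, smul_eq_mul]

open Polynomial in
lemma poly_id {n : ℕ} (μ : Yd n) : ∑ g, C (om μ (MonoidAlgebra.single g 1)) * X ^ numCycles g = Pp μ.1 := by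
  apply Polynomial.eq_of_infinite_eval_eq
  refine (Set.Ioi_infinite (0:ℝ)).mono (fun x hx => ?_)
  rw [Set.mem_ofPred_eq]
  have h := om_pow μ x (ne_of_gt hx)
  rw [om_toA, yd_prod μ (fun i j => x + (j:ℝ) - i)] at h
  unfold Pp
  rw [Polynomial.eval_prod, Polynomial.eval_finsetSum]
  simp only [Polynomial.eval_mul, Polynomial.eval_C, Polynomial.eval_pow, Polynomial.eval_X, Polynomial.eval_add]
  simp only [mul_comm] at h ⊢
  rw [h]
  refine Finset.prod_congr rfl fun c _ => by ring

open Polynomial in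
lemma om_nc1 {n : ℕ} (μ : Yd n) : om μ (toA (fun g => (numCycles g : ℝ))) = (derivative (Pp μ.1)).eval 1 := by
  rw [om_toA, ← poly_id, derivative_sum, eval_finsetSum]
  refine Finset.sum_congr rfl fun g _ => ?_
  simp [derivative_X_pow]
  ring

open Polynomial in
lemma om_nc2 {n : ℕ} (μ : Yd n) : om μ (toA (fun g => (numCycles g : ℝ) * (numCycles g - 1))) = (derivative (derivative (Pp μ.1))).eval 1 := by
  rw [om_toA, ← poly_id, derivative_sum, derivative_sum, eval_finsetSum]
  refine Finset.sum_congr rfl fun g _ => ?_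
  rcases numCycles g with _ | m
  · simp
  · simp [derivative_X_pow]
    ring

noncomputable def H1 (n : ℕ) : ℝ := ∑ i ∈ Finset.range n, 1 / ((i:ℝ) + 1)
noncomputable def H2 (n : ℕ) : ℝ := ∑ i ∈ Finset.range n, 1 / ((i:ℝ) + 1) ^ 2

open Polynomial in
lemma Pp_row (n : ℕ) : Pp (rowY n) = ∏ j ∈ Finset.range n, (X + C (j:ℝ)) := by
  unfold Pp rowY
  simp [Finset.prod_product]

open Polynomial in
lemma row_eval (n : ℕ) : (∏ j ∈ Finset.range n, (X + C (j:ℝ))).eval (1:ℝ) = (n.factorial:ℝ) ∧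
    (derivative (∏ j ∈ Finset.range n, (X + C (j:ℝ)))).eval 1 = n.factorial * H1 n ∧
    (derivative (derivative (∏ j ∈ Finset.range n, (X + C (j:ℝ))))).eval 1 = n.factorial * (H1 n ^ 2 - H2 n) := by
  induction n with
  | zero => simp [H1, H2]
  | succ n ih =>
    obtain ⟨h0, h1, h2⟩ := ih
    simp only [Finset.prod_range_succ, derivative_mul, derivative_add, derivative_X, derivative_C, eval_mul, eval_add, eval_X, eval_C,
      eval_one, eval_zero, add_zero, mul_one, h0, h1, h2, Nat.factorial_succ, Nat.cast_mul, Nat.cast_add, Nat.cast_one]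
    unfold H1 H2
    rw [Finset.sum_range_succ, Finset.sum_range_succ]
    have : (n:ℝ) + 1 ≠ 0 := by positivity
    refine ⟨by ring, ?_, ?_⟩
    · field_simp; ring
    · field_simp; ring

noncomputable def Qd (μ : YoungDiagram) : ℝ := ∏ c ∈ μ.cells, (|1 + (c.2:ℝ) - c.1| + 1/2)

open Polynomial in
lemma coeff_dom {ι : Type*} (s : Finset ι) (a : ι → ℝ) (k : ℕ) :
    |(∏ i ∈ s, (X + C (a i))).coeff k| ≤ (∏ i ∈ s, (X + C |a i|)).coeff k := by
  classical
  induction s using Finset.induction_on generalizing k with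
  | empty => simp [coeff_one]; split <;> simp
  | insert i s hi ih =>
    rw [Finset.prod_insert hi, Finset.prod_insert hi, add_mul, add_mul, coeff_add, coeff_add, coeff_C_mul, coeff_C_mul]
    refine (abs_add_le _ _).trans (add_le_add ?_ ?_)
    · rcases k with _ | k
      · simp
      · rw [coeff_X_mul, coeff_X_mul]; exact ih k
    · rw [abs_mul]; exact mul_le_mul_of_nonneg_left (ih k) (abs_nonneg _)

open Polynomial in
lemma coeff_le_eval (S : Polynomial ℝ) (h : ∀ k, 0 ≤ S.coeff k) (k : ℕ) (t : ℝ) (ht : 0 ≤ t) : S.coeff k * t ^ k ≤ S.eval t := by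
  rw [eval_eq_sum_range' (n := max (S.natDegree + 1) (k+1)) (by simp)]
  exact Finset.single_le_sum (f := fun i => S.coeff i * t ^ i) (fun i _ => mul_nonneg (h i) (pow_nonneg ht i)) (by simp)

open Polynomial in
lemma Pp_taylor (μ : YoungDiagram) (k : ℕ) : |(taylor 1 (Pp μ)).coeff k| * (1/2) ^ k ≤ Qd μ := by
  have h1 : taylor 1 (Pp μ) = ∏ c ∈ μ.cells, (X + C (1 + (c.2:ℝ) - c.1)) := by
    unfold Pp
    rw [taylor_apply, Polynomial.prod_comp]
    refine Finset.prod_congr rfl fun c _ => ?_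
    simp; ring
  rw [h1]
  have h2 := coeff_dom μ.cells (fun c => 1 + (c.2:ℝ) - c.1)
  refine (mul_le_mul_of_nonneg_right (h2 k) (by positivity)).trans ?_
  refine (coeff_le_eval _ (fun k => (abs_nonneg _).trans (h2 k)) k (1/2) (by norm_num)).trans (le_of_eq ?_)
  unfold Qd
  rw [eval_prod]
  refine Finset.prod_congr rfl fun c _ => ?_
  simp; ring

open Polynomial in
lemma d1_le (μ : YoungDiagram) : |(derivative (Pp μ)).eval 1| ≤ 2 * Qd μ := by
  have := Pp_taylor μ 1
  rw [taylor_coeff_one] at this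
  linarith

open Polynomial in
lemma d2_le (μ : YoungDiagram) : |(derivative (derivative (Pp μ))).eval 1| ≤ 8 * Qd μ := by
  have h := Pp_taylor μ 2
  rw [taylor_coeff] at h
  have h2 : derivative (derivative (Pp μ)) = 2 * (hasseDeriv 2 (Pp μ)) := by
    have := congrFun (factorial_smul_hasseDeriv (R := ℝ) 2) (Pp μ)
    simp at this
    rw [← this]
  rw [h2, eval_mul, abs_mul]
  simp
  linarith

lemma Qd_nonneg (μ : YoungDiagram) : 0 ≤ Qd μ := Finset.prod_nonneg fun _ _ => by positivity


noncomputable def TT (n : ℕ) : ℝ := ((∑ μ : Yd n, Qd μ.1) - Qd (rowY n)) / n.factorial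

lemma rest_le {n : ℕ} (c : ℝ) (a : Yd n → ℝ) (h : ∀ μ, |a μ| ≤ c * Qd μ.1) :
    |(∑ μ, a μ) / n.factorial - a (rowD n) / n.factorial| ≤ c * TT n := by
  classical
  have hN := fac_pos n
  unfold TT
  rw [← sub_div, abs_div, abs_of_pos hN, ← mul_div_assoc]
  gcongr
  rw [← Finset.sum_erase_add _ _ (Finset.mem_univ (rowD n)), ← Finset.sum_erase_add _ _ (Finset.mem_univ (rowD n))]
  rw [show (rowD n).1 = rowY n from rfl]
  rw [add_sub_cancel_right, add_sub_cancel_right, Finset.mul_sum]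
  exact (Finset.abs_sum_le_sum_abs _ _).trans (Finset.sum_le_sum fun μ _ => h μ)

lemma pw_le {n : ℕ} (μ : Yd n) (j : ℕ) (x : ℝ) : |om μ (pE n) ^ j * x| ≤ |x| := by
  rw [abs_mul, abs_pow]
  exact mul_le_of_le_one_left (abs_nonneg _) (pow_le_one₀ (abs_nonneg _) (om_pE_le μ))

lemma row_nc1 (n : ℕ) : om (rowD n) (toA (fun g => (numCycles g : ℝ))) = n.factorial * H1 n := by
  rw [om_nc1, show (rowD n).1 = rowY n from rfl, Pp_row, (row_eval n).2.1]

lemma row_nc2 (n : ℕ) : om (rowD n) (toA (fun g => (numCycles g : ℝ) * (numCycles g - 1))) = n.factorial * (H1 n ^ 2 - H2 n) := by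
  rw [om_nc2, show (rowD n).1 = rowY n from rfl, Pp_row, (row_eval n).2.2]

lemma even_m1 (n j : ℕ) : |expectK n (2 * (j+1)) (fun v => (numCycles (wd v) : ℝ)) - H1 n| ≤ 2 * TT n := by
  have hN := fac_pos n
  have h := even_formula (n := n) j (isCl_nc (fun m => (m:ℝ)))
  rw [h]
  have := rest_le (n := n) 2 (fun μ => om μ (pE n) ^ j * om μ (toA (fun g => (numCycles g : ℝ)))) (fun μ =>
    (pw_le μ j _).trans (by rw [om_nc1]; exact d1_le _))
  simp only [om_row_pE, one_pow, one_mul, row_nc1] at this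
  rwa [mul_div_cancel_left₀ _ hN.ne'] at this

lemma even_m2 (n j : ℕ) : |expectK n (2 * (j+1)) (fun v => (numCycles (wd v) : ℝ) * (numCycles (wd v) - 1)) - (H1 n ^ 2 - H2 n)| ≤ 8 * TT n := by
  have hN := fac_pos n
  have h := even_formula (n := n) j (isCl_nc (fun m => (m:ℝ) * (m - 1)))
  rw [h]
  have := rest_le (n := n) 8 (fun μ => om μ (pE n) ^ j * om μ (toA (fun g => (numCycles g : ℝ) * (numCycles g - 1)))) (fun μ =>
    (pw_le μ j _).trans (by rw [om_nc2]; exact d2_le _))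
  simp only [om_row_pE, one_pow, one_mul, row_nc2] at this
  rwa [mul_div_cancel_left₀ _ hN.ne'] at this

lemma TT_nonneg (n : ℕ) : 0 ≤ TT n := by
  have := rest_le (n := n) 1 (fun _ => 0) (fun μ => by simp [Qd_nonneg])
  simpa using this

lemma unif_m1 (n : ℕ) : (∑ g : Perm (Fin n), (numCycles g : ℝ)) / n.factorial = H1 n := by
  have hN := fac_pos n
  have := row_nc1 n
  rw [om_row] at this
  simp only [toA_coeff] at this
  rw [this, mul_div_cancel_left₀ _ hN.ne']

lemma unif_m2 (n : ℕ) : (∑ g : Perm (Fin n), (numCycles g : ℝ) * (numCycles g - 1)) / n.factorial = H1 n ^ 2 - H2 n := by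
  have hN := fac_pos n
  have := row_nc2 n
  rw [om_row] at this
  simp only [toA_coeff] at this
  rw [this, mul_div_cancel_left₀ _ hN.ne']

lemma odd_cov (n j : ℕ) : |expectK n (2 * (j+1) + 1) (fun v => (numCycles (List.ofFn v).prod : ℝ) * numCycles (List.ofFn fun i => (v i)⁻¹).prod)
    - H1 n ^ 2| ≤ 4 * TT n ^ 2 := by
  classical
  have hN := fac_pos n
  have h := odd_formula (n := n) j (isCl_nc (fun m => (m:ℝ))) (isCl_nc (fun m => (m:ℝ)))
  rw [h, ← Finset.sum_erase_add _ _ (Finset.mem_univ (rowD n)), om_row_pE, row_nc1, add_div]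
  rw [show (1 ^ j * (n.factorial * H1 n * (n.factorial * H1 n))) / (n.factorial:ℝ)^2 = H1 n ^ 2 by field_simp; simp]
  rw [add_sub_cancel_right, abs_div, abs_of_pos (by positivity : (0:ℝ) < (n.factorial:ℝ)^2)]
  have h4 : 4 * TT n ^ 2 = (2 * ∑ μ ∈ Finset.univ.erase (rowD n), Qd μ.1)^2 / (n.factorial:ℝ)^2 := by
    unfold TT
    rw [← Finset.sum_erase_add _ _ (Finset.mem_univ (rowD n)), show (rowD n).1 = rowY n from rfl, add_sub_cancel_right]
    field_simp
    ring
  rw [h4]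
  gcongr
  refine (Finset.abs_sum_le_sum_abs _ _).trans ?_
  have h5 : ∀ μ : Yd n, |om μ (pE n) ^ j * (om μ (toA (fun g => (numCycles g : ℝ))) * om μ (toA (fun g => (numCycles g : ℝ))))| ≤ (2 * Qd μ.1) ^ 2 := by
    intro μ
    refine (pw_le μ j _).trans ?_
    rw [om_nc1, abs_mul, ← sq]
    exact pow_le_pow_left₀ (abs_nonneg _) (d1_le _) 2
  refine (Finset.sum_le_sum fun μ _ => h5 μ).trans ?_
  rw [Finset.mul_sum]
  exact Finset.sum_sq_le_sq_sum_of_nonneg (fun μ _ => by have := Qd_nonneg μ.1; positivity)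

end

section

def shf (c : ℕ × ℕ) : ℕ × ℕ := (c.1 + 1, c.2 + 1)
lemma shf_inj : Function.Injective shf := by
  rintro ⟨a, b⟩ ⟨c, d⟩ h
  simp [shf] at h ⊢; exact h

noncomputable def innerY (μ : YoungDiagram) : YoungDiagram where
  cells := μ.cells.preimage shf shf_inj.injOn
  isLowerSet := by
    rintro ⟨a, b⟩ ⟨c, d⟩ ⟨h1, h2⟩ h
    simp only [Finset.coe_preimage, Set.mem_preimage, Finset.mem_coe, shf] at h ⊢
    exact μ.up_left_mem (by simpa using h1) (by simpa using h2) h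

lemma mem_innerY (μ : YoungDiagram) (i j : ℕ) : (i, j) ∈ (innerY μ).cells ↔ (i+1, j+1) ∈ μ.cells := by
  simp [innerY, shf]

lemma prod_peel {M : Type*} [CommMonoid M] (μ : YoungDiagram) (F : ℕ → ℕ → M) :
    ∏ c ∈ μ.cells, F c.1 c.2 = (∏ j ∈ Finset.range (μ.rowLen 0), F 0 j) *
      (∏ i ∈ Finset.range (μ.colLen 0 - 1), F (i+1) 0) * ∏ c ∈ (innerY μ).cells, F (c.1+1) (c.2+1) := by
  classical
  have h1 : μ.cells = (Finset.range (μ.rowLen 0)).image (fun j => (0, j)) ∪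
      ((Finset.range (μ.colLen 0 - 1)).image (fun i => (i+1, 0)) ∪ (innerY μ).cells.image shf) := by
    ext ⟨i, j⟩
    simp only [Finset.mem_union, Finset.mem_image, Finset.mem_range, Prod.mk.injEq, YoungDiagram.mem_cells]
    rcases i with _ | i
    · simp [YoungDiagram.mem_iff_lt_rowLen, shf]
    · rcases j with _ | j
      · simp [YoungDiagram.mem_iff_lt_colLen, shf]
        omega
      · simp [shf]
        rw [← YoungDiagram.mem_cells, ← YoungDiagram.mem_cells, mem_innerY]
  rw [h1, Finset.prod_union, Finset.prod_union, Finset.prod_image, Finset.prod_image, Finset.prod_image, mul_assoc]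
  · rfl
  · exact shf_inj.injOn
  · intro a _ b _ h; simpa using h
  · intro a _ b _ h; simpa using h
  · rw [Finset.disjoint_left]; rintro ⟨i, j⟩ h h'; simp [shf] at h h'; omega
  · rw [Finset.disjoint_left]; rintro ⟨i, j⟩ h h'; simp [shf] at h h'; omega

lemma card_peel (μ : YoungDiagram) : μ.card = μ.rowLen 0 + (μ.colLen 0 - 1) + (innerY μ).card := by
  have h := prod_peel μ (fun _ _ => (2:ℕ))
  simp only [Finset.prod_const, Finset.card_range, ← pow_add] at h
  exact Nat.pow_right_injective le_rfl h

noncomputable def UU (a : ℕ) : ℝ := ∏ j ∈ Finset.range a, ((j:ℝ) + 3/2)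

lemma UU_succ (a : ℕ) : UU (a+1) = UU a * (a + 3/2) := Finset.prod_range_succ _ _
lemma UU_pos (a : ℕ) : 0 < UU a := Finset.prod_pos fun _ _ => by positivity

lemma Qd_peel (μ : YoungDiagram) : Qd μ ≤ UU (μ.rowLen 0) * UU (μ.colLen 0 - 1) * Qd (innerY μ) := by
  unfold Qd
  rw [prod_peel μ (fun i j => |1 + (j:ℝ) - i| + 1/2)]
  have h3 : ∏ c ∈ (innerY μ).cells, (|1 + ((c.2+1:ℕ):ℝ) - ((c.1+1:ℕ):ℝ)| + 1/2) = ∏ c ∈ (innerY μ).cells, (|1 + (c.2:ℝ) - c.1| + 1/2) := by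
    refine Finset.prod_congr rfl fun c _ => ?_
    push_cast; congr 2; ring
  rw [h3]
  have h1 : ∏ j ∈ Finset.range (μ.rowLen 0), (|1 + (j:ℝ) - (0:ℕ)| + 1/2) = UU (μ.rowLen 0) := by
    refine Finset.prod_congr rfl fun j _ => ?_
    rw [Nat.cast_zero, sub_zero, abs_of_pos (by positivity)]; ring
  rw [h1]
  have h0 : ∏ i ∈ Finset.range (μ.colLen 0 - 1), (|1 + ((0:ℕ):ℝ) - ((i+1:ℕ):ℝ)| + 1/2) ≤ UU (μ.colLen 0 - 1) := by
    refine Finset.prod_le_prod (fun _ _ => by positivity) fun i _ => ?_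
    have : (1 + ((0:ℕ):ℝ) - ((i+1:ℕ):ℝ)) = -(i:ℝ) := by push_cast; ring
    rw [this, abs_neg, abs_of_nonneg (by positivity)]; linarith
  have := UU_pos (μ.rowLen 0)
  have h5 : 0 ≤ ∏ c ∈ (innerY μ).cells, (|1 + (c.2:ℝ) - c.1| + 1/2) := Finset.prod_nonneg fun _ _ => by positivity
  gcongr

lemma innerY_inj (μ ν : YoungDiagram) (h0 : 0 < μ.card) (h0' : 0 < ν.card) (h1 : μ.rowLen 0 = ν.rowLen 0) (h2 : μ.colLen 0 - 1 = ν.colLen 0 - 1)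
    (h3 : innerY μ = innerY ν) : μ = ν := by
  have hp : ∀ μ : YoungDiagram, 0 < μ.card → (0,0) ∈ μ := by
    intro μ h
    obtain ⟨⟨i, j⟩, hc⟩ := Finset.card_pos.1 h
    exact μ.up_left_mem (Nat.zero_le _) (Nat.zero_le _) hc
  have a1 := YoungDiagram.mem_iff_lt_colLen.1 (hp μ h0)
  have a2 := YoungDiagram.mem_iff_lt_colLen.1 (hp ν h0')
  apply YoungDiagram.ext
  ext ⟨i, j⟩
  rcases i with _ | i
  · simp [YoungDiagram.mem_iff_lt_rowLen, h1]
  · rcases j with _ | j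
    · simp only [YoungDiagram.mem_cells, YoungDiagram.mem_iff_lt_colLen]; omega
    · rw [← mem_innerY, ← mem_innerY, h3]

lemma rowLen_pos (μ : YoungDiagram) (h : 0 < μ.card) : 0 < μ.rowLen 0 := by
  obtain ⟨⟨i, j⟩, hc⟩ := Finset.card_pos.1 h
  exact YoungDiagram.mem_iff_lt_rowLen.1 (μ.up_left_mem (Nat.zero_le _) (Nat.zero_le _) hc)

noncomputable def BB (n : ℕ) : ℝ := ∑ μ : Yd n, Qd μ.1

lemma BB_nonneg (n : ℕ) : 0 ≤ BB n := Finset.sum_nonneg fun _ _ => Qd_nonneg _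

lemma BB_rec (n : ℕ) (hn : 0 < n) : BB n ≤ ∑ s ∈ Finset.range n, UU (n - s) *
    ∑ p ∈ Finset.HasAntidiagonal.antidiagonal s, UU p.1 * BB p.2 := by
  classical
  let F : (Σ _ : ℕ, Σ p : ℕ × ℕ, Yd p.2) → ℝ := fun x => UU (n - x.1) * (UU x.2.1.1 * Qd x.2.2.1)
  let φ : Yd n → (Σ _ : ℕ, Σ p : ℕ × ℕ, Yd p.2) := fun μ =>
    ⟨(μ.1.colLen 0 - 1) + (innerY μ.1).card, ⟨(μ.1.colLen 0 - 1, (innerY μ.1).card), ⟨innerY μ.1, rfl⟩⟩⟩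
  have hφ : Function.Injective φ := by
    intro μ ν h
    have e1 : μ.1.colLen 0 - 1 = ν.1.colLen 0 - 1 := congrArg (fun x => x.2.1.1) h
    have e2 : innerY μ.1 = innerY ν.1 := congrArg (fun x : (Σ _ : ℕ, Σ p : ℕ × ℕ, Yd p.2) => x.2.2.1) h
    have c1 := card_peel μ.1
    have c2 := card_peel ν.1
    rw [μ.2] at c1
    rw [ν.2, ← e1, ← e2] at c2
    exact Subtype.ext (innerY_inj _ _ (by rw [μ.2]; exact hn) (by rw [ν.2]; exact hn) (by omega) e1 e2)
  have hF : ∀ μ : Yd n, Qd μ.1 ≤ F (φ μ) := by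
    intro μ
    have c1 := card_peel μ.1
    rw [μ.2] at c1
    have := Qd_peel μ.1
    rw [mul_assoc] at this
    have e : n - ((μ.1.colLen 0 - 1) + (innerY μ.1).card) = μ.1.rowLen 0 := by omega
    simp only [F, φ, e]
    exact this
  calc BB n ≤ ∑ μ : Yd n, F (φ μ) := Finset.sum_le_sum fun μ _ => hF μ
    _ = ∑ x ∈ Finset.univ.image φ, F x := (Finset.sum_image (fun a _ b _ h => hφ h)).symm
    _ ≤ ∑ x ∈ (Finset.range n).sigma (fun s => (Finset.HasAntidiagonal.antidiagonal s).sigma (fun p => (Finset.univ : Finset (Yd p.2)))), F x := by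
        apply Finset.sum_le_sum_of_subset_of_nonneg
        · intro x hx
          obtain ⟨μ, _, rfl⟩ := Finset.mem_image.1 hx
          have c1 := card_peel μ.1
          have c2 := rowLen_pos μ.1 (by rw [μ.2]; exact hn)
          rw [μ.2] at c1
          simp only [φ, Finset.mem_sigma, Finset.mem_range, Finset.HasAntidiagonal.mem_antidiagonal, Finset.mem_univ, and_true]
          omega
        · intro x _ _
          have := UU_pos (n - x.1)
          have := UU_pos x.2.1.1
          have := Qd_nonneg x.2.2.1
          positivity
    _ = _ := by
        rw [Finset.sum_sigma]
        refine Finset.sum_congr rfl fun s _ => ?_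
        rw [Finset.sum_sigma, Finset.mul_sum]
        refine Finset.sum_congr rfl fun p _ => ?_
        simp only [F, BB, Finset.mul_sum]

lemma Qd_row (n : ℕ) : Qd (rowY n) = UU n := by
  unfold Qd rowY UU
  simp only [Finset.prod_product, Finset.prod_singleton]
  refine Finset.prod_congr rfl fun j _ => ?_
  rw [Nat.cast_zero, sub_zero, abs_of_pos (by positivity)]; ring

lemma BB_zero : BB 0 = 1 := by
  have : ∀ μ : Yd 0, μ = rowD 0 := by
    intro μ
    apply Subtype.ext; apply YoungDiagram.ext
    rw [Finset.card_eq_zero.1 μ.2, Finset.card_eq_zero.1 (rowD 0).2]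
  unfold BB
  rw [Fintype.sum_eq_single (rowD 0) (fun μ h => absurd (this μ) h)]
  rw [show (rowD 0).1 = rowY 0 from rfl, Qd_row]; simp [UU]

lemma UU_conv (t i j : ℕ) : UU (i + t) * UU (j + t) ≤ UU t * UU (i + j + t) := by
  induction i with
  | zero => simp
  | succ i ih =>
    rw [show i + 1 + t = (i + t) + 1 by ring, show i + 1 + j + t = (i + j + t) + 1 by ring, UU_succ, UU_succ]
    have h1 := UU_pos (i+j+t)
    have h2 := UU_pos t
    calc UU (i+t) * (((i+t:ℕ):ℝ) + 3/2) * UU (j+t) = (UU (i+t) * UU (j+t)) * (((i+t:ℕ):ℝ) + 3/2) := by ring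
      _ ≤ (UU t * UU (i+j+t)) * (((i+j+t:ℕ):ℝ) + 3/2) := by
        gcongr; omega
      _ = _ := by ring

lemma UU0 : UU 0 = 1 := by simp [UU]
lemma UU1 : UU 1 = 3/2 := by simp [UU]
lemma UU2 : UU 2 = 15/4 := by simp [UU, Finset.prod_range_succ]; norm_num

lemma conv1 (t : ℕ) : ∑ p ∈ Finset.HasAntidiagonal.antidiagonal t, UU (p.1+1) * UU (p.2+1) ≤ 7 * UU (t+1) := by
  rcases t with _ | _ | r
  · simp [UU1]; norm_num
  · simp [Finset.Nat.antidiagonal_succ, UU1, UU2]; norm_num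
  · rw [Finset.Nat.antidiagonal_succ_succ']
    simp only [Finset.sum_cons, Finset.sum_map]
    have h : ∑ p ∈ Finset.HasAntidiagonal.antidiagonal r, UU (p.1+2) * UU (p.2+2) ≤ (r+1) * (UU 2 * UU (r+2)) := by
      calc _ ≤ ∑ p ∈ Finset.HasAntidiagonal.antidiagonal r, UU 2 * UU (r+2) := by
            refine Finset.sum_le_sum fun p hp => ?_
            have := UU_conv 2 p.1 p.2
            rwa [Finset.HasAntidiagonal.mem_antidiagonal.1 hp] at this
        _ = _ := by simp
    have e : UU (r+2+1) = UU (r+2) * (r + 2 + 3/2) := by rw [UU_succ]; push_cast; ring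
    have hp := UU_pos (r+2)
    have hr : (0:ℝ) ≤ r := by positivity
    simp only [Function.Embedding.prodMap, Function.Embedding.coeFn_mk, Prod.map, Nat.succ_eq_add_one]
    rw [UU2] at h
    simp only [zero_add, UU1] at *
    norm_num [add_assoc] at *
    rw [show r + 3 = r + 2 + 1 by ring] at *
    rw [e]
    nlinarith

lemma conv2 (s : ℕ) : ∑ p ∈ Finset.HasAntidiagonal.antidiagonal s, UU p.1 * UU p.2 ≤ 9 * UU s := by
  rcases s with _ | _ | t
  · simp [UU0]
  · simp [Finset.Nat.antidiagonal_succ, UU1, UU0]; norm_num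
  · rw [Finset.Nat.antidiagonal_succ_succ']
    simp only [Finset.sum_cons, Finset.sum_map]
    have h := conv1 t
    have e : UU (t+2) = UU (t+1) * (t + 1 + 3/2) := by rw [UU_succ]; push_cast; ring
    have hp := UU_pos (t+1)
    simp only [Function.Embedding.prodMap, Function.Embedding.coeFn_mk, Prod.map, Nat.succ_eq_add_one, UU0]
    have hr : (0:ℝ) ≤ t := by positivity
    rw [show t + 1 + 1 = t + 2 by ring, e] at *
    nlinarith

lemma BB_step (n : ℕ) (K : ℝ) (hK0 : 0 ≤ K) (hK : ∀ m < n + 1, BB m ≤ K * UU m) :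
    BB (n+1) ≤ UU (n+1) + 63 * K * UU n := by
  refine (BB_rec (n+1) (by omega)).trans ?_
  rw [Finset.sum_range_succ']
  have h0 : UU (n+1-0) * ∑ p ∈ Finset.HasAntidiagonal.antidiagonal 0, UU p.1 * BB p.2 = UU (n+1) := by
    simp [UU0, BB_zero]
  rw [h0, add_comm]
  gcongr
  rcases n with _ | t
  · have := UU_pos 0
    simp; positivity
  · calc ∑ k ∈ Finset.range (t+1), UU (t+1+1-(k+1)) * ∑ p ∈ Finset.HasAntidiagonal.antidiagonal (k+1), UU p.1 * BB p.2
        ≤ ∑ k ∈ Finset.range (t+1), 9 * K * (UU (k+1) * UU (t-k+1)) := by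
          refine Finset.sum_le_sum fun k hk => ?_
          have hk' := Finset.mem_range.1 hk
          have h1 : ∑ p ∈ Finset.HasAntidiagonal.antidiagonal (k+1), UU p.1 * BB p.2 ≤ K * (9 * UU (k+1)) := by
            refine le_trans ?_ (mul_le_mul_of_nonneg_left (conv2 (k+1)) hK0)
            rw [Finset.mul_sum]
            refine Finset.sum_le_sum fun p hp => ?_
            have := Finset.HasAntidiagonal.mem_antidiagonal.1 hp
            have h2 := hK p.2 (by omega)
            have := UU_pos p.1
            nlinarith
          have e : t + 1 + 1 - (k+1) = t - k + 1 := by omega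
          rw [e]
          have := UU_pos (t-k+1)
          nlinarith
      _ = 9 * K * ∑ p ∈ Finset.HasAntidiagonal.antidiagonal t, UU (p.1+1) * UU (p.2+1) := by
          rw [← Finset.mul_sum, Finset.Nat.sum_antidiagonal_eq_sum_range_succ (fun i j => UU (i+1) * UU (j+1))]
      _ ≤ 9 * K * (7 * UU (t+1)) := by gcongr; exact conv1 t
      _ = _ := by ring

lemma BB_init : ∃ K : ℝ, 2 ≤ K ∧ ∀ m < 126, BB m ≤ K * UU m := by
  have hs : ∀ N : ℕ, 0 ≤ ∑ m ∈ Finset.range N, BB m / UU m := fun N =>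
    Finset.sum_nonneg fun m _ => div_nonneg (BB_nonneg m) (UU_pos m).le
  refine ⟨2 + ∑ m ∈ Finset.range 126, BB m / UU m, le_add_of_nonneg_right (hs _), ?_⟩
  intro m hm
  have : BB m / UU m ≤ ∑ m ∈ Finset.range 126, BB m / UU m :=
    Finset.single_le_sum (f := fun m => BB m / UU m) (fun m _ => div_nonneg (BB_nonneg m) (UU_pos m).le) (Finset.mem_range.2 hm)
  rw [← div_le_iff₀ (UU_pos m)]
  exact this.trans (le_add_of_nonneg_left zero_le_two)

lemma BB_bound : ∃ K : ℝ, 0 ≤ K ∧ ∀ m, BB m ≤ K * UU m := by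
  obtain ⟨K, hK0, hKs⟩ := BB_init
  refine ⟨K, by linarith, ?_⟩
  intro m
  induction m using Nat.strong_induction_on with
  | _ m ih =>
    by_cases hm : m < 126
    · exact hKs m hm
    · obtain ⟨n, rfl⟩ : ∃ n, m = n + 1 := ⟨m - 1, by omega⟩
      have h := BB_step n K (by linarith) ih
      rw [UU_succ] at h ⊢
      have hp := UU_pos n
      have hn : (125:ℝ) ≤ n := by exact_mod_cast (by omega : 125 ≤ n)
      have h1 : 2 * (UU n * (n + 3/2)) ≤ K * (UU n * (n + 3/2)) := mul_le_mul_of_nonneg_right hK0 (by positivity)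
      have h2 : 126 * (K * UU n) ≤ (n + 3/2) * (K * UU n) :=
        mul_le_mul_of_nonneg_right (by linarith) (mul_nonneg (by linarith) hp.le)
      linarith

lemma UU_sq (m : ℕ) : UU m ^ 2 ≤ (2 * m + 1) * (m.factorial : ℝ) ^ 2 := by
  induction m with
  | zero => simp [UU0]
  | succ m ih =>
    rw [UU_succ, Nat.factorial_succ]
    push_cast
    have hN := fac_pos m
    calc (UU m * (m + 3/2))^2 = UU m ^ 2 * (m + 3/2)^2 := by ring
      _ ≤ ((2 * m + 1) * (m.factorial : ℝ) ^ 2) * (m + 3/2)^2 := by gcongr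
      _ = (m.factorial : ℝ) ^ 2 * ((2*m+1) * (m+3/2)^2) := by ring
      _ ≤ (m.factorial : ℝ) ^ 2 * ((2*(m+1)+1) * (m+1)^2) := by
        refine mul_le_mul_of_nonneg_left ?_ (by positivity)
        have : (0:ℝ) ≤ m := by positivity
        nlinarith
      _ = _ := by ring

lemma TT_bound : ∃ K : ℝ, 0 ≤ K ∧ ∀ n : ℕ, 0 < n → TT n ≤ K / Real.sqrt n := by
  obtain ⟨K, hK0, hK⟩ := BB_bound
  refine ⟨63 * K * 2, by positivity, ?_⟩
  intro n hn
  obtain ⟨m, rfl⟩ : ∃ m, n = m + 1 := ⟨n - 1, by omega⟩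
  have hN := fac_pos m
  have h := BB_step m K hK0 (fun i _ => hK i)
  unfold TT
  rw [Qd_row]
  change (BB (m+1) - UU (m+1)) / _ ≤ _
  have hm : (0:ℝ) < ((m+1:ℕ):ℝ) := by positivity
  have hs := Real.sqrt_pos.2 hm
  have hss := Real.sq_sqrt hm.le
  have h2 : UU m ≤ 2 * Real.sqrt ((m+1:ℕ):ℝ) * m.factorial := by
    apply le_of_sq_le_sq _ (by positivity)
    refine (UU_sq m).trans ?_
    rw [mul_pow, mul_pow, hss]
    gcongr
    push_cast; linarith
  rw [div_le_div_iff₀ (fac_pos _) hs, Nat.factorial_succ]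
  have h3 : BB (m+1) - UU (m+1) ≤ 63 * K * (2 * Real.sqrt ((m+1:ℕ):ℝ) * m.factorial) := by
    have : 63 * K * UU m ≤ 63 * K * (2 * Real.sqrt ((m+1:ℕ):ℝ) * m.factorial) := by gcongr
    linarith
  calc _ ≤ 63 * K * (2 * Real.sqrt ((m+1:ℕ):ℝ) * m.factorial) * Real.sqrt ((m+1:ℕ):ℝ) := by gcongr
    _ = 63 * K * 2 * (Real.sqrt ((m+1:ℕ):ℝ) ^ 2 * m.factorial) := by ring
    _ = _ := by rw [hss]; push_cast; ring

open Filter in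
lemma TT_log : Tendsto (fun n : ℕ => TT n * Real.log n) atTop (nhds 0) := by
  obtain ⟨K, hK0, hK⟩ := TT_bound
  have h1 : Tendsto (fun x : ℝ => Real.log x / x ^ (1/2 : ℝ)) atTop (nhds 0) :=
    (isLittleO_log_rpow_atTop (by norm_num)).tendsto_div_nhds_zero
  have h2 := (h1.comp tendsto_natCast_atTop_atTop).const_mul K
  rw [mul_zero] at h2
  refine squeeze_zero' ?_ ?_ h2
  · exact Eventually.of_forall fun n => mul_nonneg (TT_nonneg n) (Real.log_natCast_nonneg n)
  · filter_upwards [eventually_gt_atTop 0] with n hn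
    have := mul_le_mul_of_nonneg_right (hK n hn) (Real.log_natCast_nonneg n)
    simp only [Function.comp_apply]
    rw [← Real.sqrt_eq_rpow]
    refine this.trans (le_of_eq (by ring))

open Filter in
lemma TT_zero : Tendsto (fun n : ℕ => TT n) atTop (nhds 0) := by
  refine squeeze_zero' (Eventually.of_forall TT_nonneg) ?_ TT_log
  filter_upwards [eventually_ge_atTop 3] with n hn
  have h3 : (3:ℝ) ≤ n := by exact_mod_cast hn
  have : 1 ≤ Real.log n := by
    rw [Real.le_log_iff_exp_le (by linarith)]
    linarith [Real.exp_one_lt_d9]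
  nlinarith [TT_nonneg n]

end

section
lemma ex_add (n k : ℕ) (f g : (Fin k → Equiv.Perm (Fin n)) → ℝ) :
    expectK n k (fun v => f v + g v) = expectK n k f + expectK n k g := by
  simp only [expectK, Finset.sum_add_distrib, add_div]

lemma ex_mul (n k : ℕ) (c : ℝ) (f : (Fin k → Equiv.Perm (Fin n)) → ℝ) :
    expectK n k (fun v => c * f v) = c * expectK n k f := by
  simp only [expectK, ← Finset.mul_sum, mul_div_assoc]

lemma ex_const (n k : ℕ) (c : ℝ) : expectK n k (fun _ => c) = c := by
  have := fac_pos n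
  simp only [expectK, Finset.sum_const, Finset.card_univ, Fintype.card_fun, Fintype.card_perm, Fintype.card_fin,
    nsmul_eq_mul, Nat.cast_pow]
  field_simp

lemma even_mean (n k : ℕ) : expectK n k (genusEven n k) =
    ((k:ℝ) - 1) * n / 2 - expectK n k (fun v => (numCycles (wd v) : ℝ)) / 2 + 1 := by
  have : genusEven n k = fun v => (((k:ℝ) - 1) * n / 2 + 1) + (-1/2) * (numCycles (wd v) : ℝ) := by
    funext v; unfold genusEven wd; ring
  rw [this, ex_add, ex_const, ex_mul]; ring

lemma even_var (n k : ℕ) : expectK n k (fun v => (genusEven n k v - expectK n k (genusEven n k)) ^ 2) =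
    (expectK n k (fun v => (numCycles (wd v) : ℝ) * (numCycles (wd v) - 1)) + expectK n k (fun v => (numCycles (wd v) : ℝ))
      - expectK n k (fun v => (numCycles (wd v) : ℝ)) ^ 2) / 4 := by
  rw [even_mean]
  set e := expectK n k (fun v => (numCycles (wd v) : ℝ)) with he
  have : (fun v => (genusEven n k v - (((k:ℝ) - 1) * n / 2 - e / 2 + 1)) ^ 2) =
      fun v => (1/4 * ((numCycles (wd v) : ℝ) * (numCycles (wd v) - 1)) + ((1/4 - e/2) * (numCycles (wd v) : ℝ))) + e^2/4 := by
    funext v; unfold genusEven wd; ring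
  rw [this, ex_add, ex_add, ex_const, ex_mul, ex_mul, ← he]; ring

lemma odd_m1A (n m : ℕ) : expectK n (m+1) (fun v => (numCycles (List.ofFn v).prod : ℝ)) = H1 n :=
  (marg_A m (isCl_nc fun c => (c:ℝ))).trans (unif_m1 n)
lemma odd_m1B (n m : ℕ) : expectK n (m+1) (fun v => (numCycles (List.ofFn fun i => (v i)⁻¹).prod : ℝ)) = H1 n :=
  (marg_B m (isCl_nc fun c => (c:ℝ))).trans (unif_m1 n)
lemma odd_m2A (n m : ℕ) : expectK n (m+1) (fun v => (numCycles (List.ofFn v).prod : ℝ) * (numCycles (List.ofFn v).prod - 1)) = H1 n ^ 2 - H2 n :=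
  (marg_A m (isCl_nc fun c => (c:ℝ) * (c - 1))).trans (unif_m2 n)
lemma odd_m2B (n m : ℕ) : expectK n (m+1) (fun v => (numCycles (List.ofFn fun i => (v i)⁻¹).prod : ℝ) * (numCycles (List.ofFn fun i => (v i)⁻¹).prod - 1)) = H1 n ^ 2 - H2 n :=
  (marg_B m (isCl_nc fun c => (c:ℝ) * (c - 1))).trans (unif_m2 n)

lemma odd_mean (n m : ℕ) : expectK n (m+1) (genusOdd n (m+1)) =
    (((m+1:ℕ):ℝ) - 1) * n / 2 - H1 n + 1 := by
  have : genusOdd n (m+1) = fun v => ((((m+1:ℕ):ℝ) - 1) * n / 2 + 1) + ((-1/2) * (numCycles (List.ofFn v).prod : ℝ) +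
      (-1/2) * (numCycles (List.ofFn fun i => (v i)⁻¹).prod : ℝ)) := by
    funext v; unfold genusOdd; ring
  rw [this, ex_add, ex_const, ex_add, ex_mul, ex_mul, odd_m1A, odd_m1B]; ring

lemma odd_var (n m : ℕ) : expectK n (m+1) (fun v => (genusOdd n (m+1) v - expectK n (m+1) (genusOdd n (m+1))) ^ 2) =
    (H1 n - H2 n) / 2 + (expectK n (m+1) (fun v => (numCycles (List.ofFn v).prod:ℝ) * numCycles (List.ofFn fun i => (v i)⁻¹).prod) - H1 n ^ 2) / 2 := by
  rw [odd_mean]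
  have : (fun v => (genusOdd n (m+1) v - ((((m+1:ℕ):ℝ) - 1) * n / 2 - H1 n + 1)) ^ 2) =
      fun v => ((1/4 * ((numCycles (List.ofFn v).prod : ℝ) * (numCycles (List.ofFn v).prod - 1))
        + 1/4 * ((numCycles (List.ofFn fun i => (v i)⁻¹).prod : ℝ) * (numCycles (List.ofFn fun i => (v i)⁻¹).prod - 1)))
        + ((1/4 - H1 n) * (numCycles (List.ofFn v).prod : ℝ) + (1/4 - H1 n) * (numCycles (List.ofFn fun i => (v i)⁻¹).prod : ℝ)))
        + (1/2 * ((numCycles (List.ofFn v).prod:ℝ) * numCycles (List.ofFn fun i => (v i)⁻¹).prod) + H1 n ^ 2) := by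
    funext v; unfold genusOdd; ring
  rw [this, ex_add, ex_add, ex_add, ex_add, ex_add, ex_const, ex_mul, ex_mul, ex_mul, ex_mul, ex_mul,
    odd_m1A, odd_m1B, odd_m2A, odd_m2B]; ring

open Filter in
lemma H1_lim : Tendsto (fun n : ℕ => H1 n - Real.log n) atTop (nhds Real.eulerMascheroniConstant) := by
  refine Real.tendsto_harmonic_sub_log.congr fun n => ?_
  simp [harmonic, H1]

open Filter in
lemma H2_lim : Tendsto (fun n : ℕ => H2 n) atTop (nhds (Real.pi ^ 2 / 6)) := by
  have h := hasSum_zeta_two.tendsto_sum_nat.comp (tendsto_add_atTop_nat 1)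
  refine h.congr fun n => ?_
  simp [H2, Finset.sum_range_succ']

open Filter in
lemma TT_H1 : Tendsto (fun n : ℕ => TT n * H1 n) atTop (nhds 0) := by
  have h := (TT_zero.mul H1_lim).add TT_log
  simp only [zero_mul, add_zero] at h
  refine h.congr fun n => ?_
  ring

lemma H1_nonneg (n : ℕ) : 0 ≤ H1 n := Finset.sum_nonneg fun _ _ => by positivity

open Filter in
lemma even_e1 (j : ℕ) : Tendsto (fun n : ℕ => expectK n (2*(j+1)) (fun v => (numCycles (wd v):ℝ)) - H1 n) atTop (nhds 0) := by
  refine squeeze_zero_norm (fun n => even_m1 n j) ?_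
  simpa using TT_zero.const_mul 2

open Filter in
lemma even_e2 (j : ℕ) : Tendsto (fun n : ℕ => expectK n (2*(j+1)) (fun v => (numCycles (wd v):ℝ)*(numCycles (wd v) - 1)) - (H1 n^2 - H2 n)) atTop (nhds 0) := by
  refine squeeze_zero_norm (fun n => even_m2 n j) ?_
  simpa using TT_zero.const_mul 8

open Filter in
lemma even_e3 (j : ℕ) : Tendsto (fun n : ℕ => (expectK n (2*(j+1)) (fun v => (numCycles (wd v):ℝ)) - H1 n) * H1 n) atTop (nhds 0) := by
  refine squeeze_zero_norm (a := fun n => 2 * (TT n * H1 n)) (fun n => ?_) ?_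
  · rw [Real.norm_eq_abs, abs_mul, abs_of_nonneg (H1_nonneg n), ← mul_assoc]
    exact mul_le_mul_of_nonneg_right (even_m1 n j) (H1_nonneg n)
  · simpa using TT_H1.const_mul 2

open Filter in
lemma odd_e (j : ℕ) : Tendsto (fun n : ℕ => expectK n (2*(j+1)+1) (fun v => (numCycles (List.ofFn v).prod:ℝ) * numCycles (List.ofFn fun i => (v i)⁻¹).prod) - H1 n^2) atTop (nhds 0) := by
  refine squeeze_zero_norm (fun n => odd_cov n j) ?_
  simpa using (TT_zero.pow 2).const_mul 4


end

/-- Expected genus and variance of the genus of a random polygon-tiled surface built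
from `n` regular `2k`-gons. For even `k`:
`E[G_{n,2k}] = (k-1)n/2 - log(n)/2 - γ/2 + 1 + o(1)` and
`Var[G_{n,2k}] = log(n)/4 + γ/4 - π²/24 + o(1)`; for odd `k`:
`E[G_{n,2k}] = (k-1)n/2 - log(n) - γ + 1 + o(1)` and
`Var[G_{n,2k}] = log(n)/2 + γ/2 - π²/12 + o(1)`. -/
theorem genus_statistics_polygon_tiled (k : ℕ) (hk : 2 ≤ k) :
    (Even k →
      Filter.Tendsto (fun n : ℕ =>
          expectK n k (genusEven n k) - (((k : ℝ) - 1) * n / 2 - Real.log n / 2))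
        Filter.atTop (nhds (1 - Real.eulerMascheroniConstant / 2)) ∧
      Filter.Tendsto (fun n : ℕ =>
          expectK n k (fun v => (genusEven n k v - expectK n k (genusEven n k)) ^ 2)
            - Real.log n / 4)
        Filter.atTop (nhds (Real.eulerMascheroniConstant / 4 - Real.pi ^ 2 / 24))) ∧
    (Odd k →
      Filter.Tendsto (fun n : ℕ =>
          expectK n k (genusOdd n k) - (((k : ℝ) - 1) * n / 2 - Real.log n))
        Filter.atTop (nhds (1 - Real.eulerMascheroniConstant)) ∧
      Filter.Tendsto (fun n : ℕ =>
          expectK n k (fun v => (genusOdd n k v - expectK n k (genusOdd n k)) ^ 2)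
            - Real.log n / 2)
        Filter.atTop (nhds (Real.eulerMascheroniConstant / 2 - Real.pi ^ 2 / 12))) := by
  constructor
  · rintro ⟨r, hr⟩
    obtain ⟨j, rfl⟩ : ∃ j, k = 2 * (j + 1) := ⟨r - 1, by omega⟩
    constructor
    · have h := ((even_e1 j).add H1_lim).const_mul (-1/2) |>.add_const 1
      have e : -1/2 * (0 + Real.eulerMascheroniConstant) + 1 = 1 - Real.eulerMascheroniConstant / 2 := by ring
      rw [e] at h
      refine h.congr fun n => ?_
      rw [even_mean]; ring
    · have h := ((((even_e2 j).add (even_e1 j)).add (((even_e3 j).const_mul (-2)).sub ((even_e1 j).pow 2))).add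
        (H1_lim.sub H2_lim)).const_mul (1/4)
      have e : 1/4 * (0 + 0 + (-2 * 0 - 0 ^ 2) + (Real.eulerMascheroniConstant - Real.pi ^ 2 / 6))
        = Real.eulerMascheroniConstant / 4 - Real.pi ^ 2 / 24 := by ring
      rw [e] at h
      refine h.congr fun n => ?_
      rw [even_var]; ring
  · rintro ⟨r, hr⟩
    obtain ⟨j, rfl⟩ : ∃ j, k = 2 * (j + 1) + 1 := ⟨r - 1, by omega⟩
    constructor
    · have h := H1_lim.const_mul (-1) |>.add_const 1
      have e : -1 * Real.eulerMascheroniConstant + 1 = 1 - Real.eulerMascheroniConstant := by ring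
      rw [e] at h
      refine h.congr fun n => ?_
      rw [odd_mean]; ring
    · have h := ((H1_lim.sub H2_lim).add (odd_e j)).const_mul (1/2)
      have e : 1/2 * (Real.eulerMascheroniConstant - Real.pi ^ 2 / 6 + 0)
        = Real.eulerMascheroniConstant / 2 - Real.pi ^ 2 / 12 := by ring
      rw [e] at h
      refine h.congr fun n => ?_
      rw [odd_var]; ring
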